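/- arXiv:2112.08034 — 3 statements merged into one kernel-verified Lean document; each statement's English description precedes it below -/
import Mathlib

section
/- If F is a smooth function from V to U and X is a p-weakly geometric rough path with trace X, then the tuple (F(X_t), DF(X_t), ..., D^{⌊p⌋−1}F(X_t)) of F composed with X together with its first ⌊p⌋−1 derivatives evaluated along the trace is an X-controlled path: for every multi-index β with |β| ≤ ⌊p⌋−2, ∂_β F(X_t) − Σ_{|α|≤⌊p⌋−1−|β|} ∂_{α,β}F(X_s) X^α_{s,t} = O(ω(s,t)^{(⌊p⌋−|β|)/p}). -/
/-- Multiset of all shuffles (interleavings) of two lists. -/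
def shuffles {α : Type*} : List α → List α → Multiset (List α)
  | [], bs => {bs}
  | a :: as, [] => {a :: as}
  | a :: as, b :: bs =>
      (shuffles as (b :: bs)).map (a :: ·) + (shuffles (a :: as) bs).map (b :: ·)
termination_by as bs => as.length + bs.length

/-- A control function on `[0,T]`: continuous, vanishing on the diagonal,
nonnegative, superadditive. -/
def IsControl (ω : ℝ → ℝ → ℝ) (T : ℝ) : Prop :=
  Continuous (fun st : ℝ × ℝ => ω st.1 st.2) ∧ (∀ t, ω t t = 0) ∧
    (∀ s t, 0 ≤ ω s t) ∧
    ∀ s u t, 0 ≤ s → s ≤ u → u ≤ t → t ≤ T → ω s u + ω u t ≤ ω s t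

/-- A `p`-weakly geometric rough path on `[0,T]` with values in `ℝ^d`,
in coordinates: `X s t w` is the coefficient `⟨X_{s,t}, e_w⟩` of the word `w`.
It is truncated at level `⌊p⌋`, starts at `1` in degree `0`, is continuous,
has `ω`-Hölder regularity `ω(s,t)^{|w|/p}`, satisfies Chen's multiplicativity
identity, and the shuffle (integration-by-parts/geometricity) identity. -/
structure RoughPath (d : ℕ) (p T : ℝ) (ω : ℝ → ℝ → ℝ) where
  X : ℝ → ℝ → List (Fin d) → ℝ
  empty_eq : ∀ s t, X s t [] = 1
  zero_of_high : ∀ s t (w : List (Fin d)), ⌊p⌋₊ < w.length → X s t w = 0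
  cont : ∀ w, Continuous fun st : ℝ × ℝ => X st.1 st.2 w
  regularity : ∃ C, ∀ w : List (Fin d), w.length ≤ ⌊p⌋₊ → ∀ s t, 0 ≤ s → s ≤ t → t ≤ T →
    |X s t w| ≤ C * ω s t ^ ((w.length : ℝ) / p)
  chen : ∀ s u t, 0 ≤ s → s ≤ u → u ≤ t → t ≤ T → ∀ w : List (Fin d), w.length ≤ ⌊p⌋₊ →
    X s t w = ∑ i ∈ Finset.range (w.length + 1), X s u (w.take i) * X u t (w.drop i)
  shuffle_rel : ∀ s t, 0 ≤ s → s ≤ t → t ≤ T → ∀ a b : List (Fin d),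
    a.length + b.length ≤ ⌊p⌋₊ →
    X s t a * X s t b = ((shuffles a b).map (X s t)).sum

/-- The partial derivative `∂_w f` of a scalar function on `ℝ^d` along the
coordinate directions given by the word `w`, evaluated at `x`. -/
noncomputable def pderivWord {d : ℕ} (f : (Fin d → ℝ) → ℝ) {n : ℕ}
    (w : Fin n → Fin d) (x : Fin d → ℝ) : ℝ :=
  iteratedFDeriv ℝ n f x fun i => Pi.single (w i) 1

/-- The iterated partial derivative of `f` along the letters of a list, the last letter being
differentiated first. -/
noncomputable def listDeriv {d : ℕ} (f : (Fin d → ℝ) → ℝ) : List (Fin d) → (Fin d → ℝ) → ℝ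
  | [] => f
  | a :: w => fun y => fderiv ℝ (listDeriv f w) y (Pi.single a 1)

lemma contDiff_listDeriv {d : ℕ} {f : (Fin d → ℝ) → ℝ} (hf : ContDiff ℝ (⊤ : ℕ∞) f)
    (w : List (Fin d)) : ContDiff ℝ (⊤ : ℕ∞) (listDeriv f w) := by
  induction w with
  | nil => exact hf
  | cons a w ih =>
    exact (ih.fderiv_right (m := (⊤ : ℕ∞)) (by simp)).clm_apply contDiff_const

lemma pderivWord_eq_listDeriv {d : ℕ} {f : (Fin d → ℝ) → ℝ} (hf : ContDiff ℝ (⊤ : ℕ∞) f)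
    {n : ℕ} (w : Fin n → Fin d) (y : Fin d → ℝ) :
    pderivWord f w y = listDeriv f (List.ofFn w) y := by
  induction n generalizing y with
  | zero => simp [pderivWord, listDeriv]
  | succ n ih =>
    have hd : DifferentiableAt ℝ (iteratedFDeriv ℝ n f) y :=
      (hf.differentiable_iteratedFDeriv (m := n)
        (by exact_mod_cast ENat.natCast_lt_top n)).differentiableAt
    rw [List.ofFn_succ, listDeriv, pderivWord, iteratedFDeriv_succ_apply_left]
    have h : listDeriv f (List.ofFn fun i => w i.succ) =
        fun z => iteratedFDeriv ℝ n f z fun i => Pi.single (w i.succ) 1 := by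
      funext z
      exact (ih (fun i => w i.succ) z).symm
    simp only [h]
    rw [fderiv_continuousMultilinear_apply_const_apply hd]
    rfl

lemma listDeriv_perm {d : ℕ} {f : (Fin d → ℝ) → ℝ} (hf : ContDiff ℝ (⊤ : ℕ∞) f)
    {w w' : List (Fin d)} (h : w.Perm w') : listDeriv f w = listDeriv f w' := by
  induction h with
  | nil => rfl
  | cons a _ ih => simp only [listDeriv, ih]
  | trans _ _ ih₁ ih₂ => exact ih₁.trans ih₂
  | swap a b w =>
    funext y
    have hw := contDiff_listDeriv hf w
    have hd : DifferentiableAt ℝ (fderiv ℝ (listDeriv f w)) y :=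
      (hw.fderiv_right (m := (⊤ : ℕ∞)) (by simp)).differentiable (by simp) y
    have hs : IsSymmSndFDerivAt ℝ (listDeriv f w) y :=
      hw.contDiffAt.isSymmSndFDerivAt (by
        simpa using (WithTop.coe_le_coe.2 le_top : ((2 : ℕ∞) : WithTop ℕ∞) ≤ _))
    simp only [listDeriv]
    rw [fderiv_clm_apply hd (differentiableAt_const _),
      fderiv_clm_apply hd (differentiableAt_const _)]
    simpa using hs _ _

lemma hasDerivAt_listDeriv_line {d : ℕ} {f : (Fin d → ℝ) → ℝ} (hf : ContDiff ℝ (⊤ : ℕ∞) f)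
    (w : List (Fin d)) (y v : Fin d → ℝ) (τ : ℝ) :
    HasDerivAt (fun τ : ℝ => listDeriv f w (y + τ • v))
      (∑ a, listDeriv f (a :: w) (y + τ • v) * v a) τ := by
  have h₁ : HasFDerivAt (listDeriv f w) (fderiv ℝ (listDeriv f w) (y + τ • v)) (y + τ • v) :=
    ((contDiff_listDeriv hf w).differentiable (by simp) _).hasFDerivAt
  have h₂ : HasDerivAt (fun τ : ℝ => y + τ • v) v τ := by
    simpa using ((hasDerivAt_id τ).smul_const v).const_add y
  have hv : v = ∑ a, v a • Pi.single a (1 : ℝ) := by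
    ext i
    simp [Finset.sum_apply, Pi.single_apply]
  have hsum : ∑ a, listDeriv f (a :: w) (y + τ • v) * v a =
      fderiv ℝ (listDeriv f w) (y + τ • v) v := by
    generalize y + τ • v = z
    conv_rhs => rw [hv, map_sum]
    refine Finset.sum_congr rfl fun a _ => ?_
    rw [map_smul, smul_eq_mul, listDeriv, mul_comm]
  rw [hsum]
  exact h₁.comp_hasDerivAt τ h₂

lemma sum_fin_succ_fun {ι : Type*} [Fintype ι] {l : ℕ} (g : (Fin (l + 1) → ι) → ℝ) :
    ∑ α, g α = ∑ a, ∑ α : Fin l → ι, g (Fin.cons a α) := by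
  rw [← (Fin.consEquiv fun _ => ι).sum_comp, Fintype.sum_prod_type]
  rfl

/-- The `l`-th directional derivative of `listDeriv f w` at `y` along `v`. -/
noncomputable def lineDerivSum {d : ℕ} (f : (Fin d → ℝ) → ℝ) (w : List (Fin d))
    (v : Fin d → ℝ) (l : ℕ) (y : Fin d → ℝ) : ℝ :=
  ∑ α : Fin l → Fin d, listDeriv f (List.ofFn α ++ w) y * ∏ i, v (α i)

lemma hasDerivAt_lineDerivSum {d : ℕ} {f : (Fin d → ℝ) → ℝ} (hf : ContDiff ℝ (⊤ : ℕ∞) f)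
    (w : List (Fin d)) (y v : Fin d → ℝ) (l : ℕ) (τ : ℝ) :
    HasDerivAt (fun τ : ℝ => lineDerivSum f w v l (y + τ • v))
      (lineDerivSum f w v (l + 1) (y + τ • v)) τ := by
  have h : lineDerivSum f w v (l + 1) (y + τ • v) = ∑ α : Fin l → Fin d,
      (∑ a, listDeriv f (a :: (List.ofFn α ++ w)) (y + τ • v) * v a) * ∏ i, v (α i) := by
    rw [lineDerivSum, sum_fin_succ_fun, Finset.sum_comm]
    simp [List.ofFn_succ, Fin.prod_univ_succ, Finset.sum_mul, mul_assoc]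
  rw [h]
  exact HasDerivAt.fun_sum fun α _ => (hasDerivAt_listDeriv_line hf _ y v τ).mul_const _

lemma abs_sub_taylor_sum_le {C : ℝ} (n : ℕ) (g : ℕ → ℝ → ℝ)
    (hg : ∀ l τ, HasDerivAt (g l) (g (l + 1) τ) τ)
    (hC : ∀ τ ∈ Set.Icc (0 : ℝ) 1, |g n τ| ≤ C) :
    ∀ τ ∈ Set.Icc (0 : ℝ) 1,
      |g 0 τ - ∑ l ∈ Finset.range n, g l 0 * (τ ^ l / l.factorial)| ≤ C := by
  induction n generalizing g with
  | zero => simpa using hC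
  | succ n ih =>
    intro τ hτ
    have hbound := ih (fun l => g (l + 1)) (fun l => hg (l + 1)) hC
    have hder : ∀ σ ∈ Set.Icc (0 : ℝ) 1, HasDerivWithinAt
        (fun τ => g 0 τ - ∑ l ∈ Finset.range (n + 1), g l 0 * (τ ^ l / l.factorial))
        (g 1 σ - ∑ l ∈ Finset.range n, g (l + 1) 0 * (σ ^ l / l.factorial))
        (Set.Icc 0 1) σ := by
      intro σ _
      refine HasDerivAt.hasDerivWithinAt ((hg 0 σ).fun_sub ?_)
      simp only [Finset.sum_range_succ', pow_zero]
      refine HasDerivAt.add_const _ (HasDerivAt.fun_sum fun l _ => HasDerivAt.const_mul _ ?_)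
      convert (hasDerivAt_pow (l + 1) σ).div_const ((l + 1).factorial : ℝ) using 1
      rw [Nat.factorial_succ]
      push_cast
      have := Nat.factorial_ne_zero l
      field_simp
    have h := (convex_Icc (0 : ℝ) 1).norm_image_sub_le_of_norm_hasDerivWithin_le hder hbound
      (Set.left_mem_Icc.2 zero_le_one) hτ
    have h0 : ∑ l ∈ Finset.range (n + 1), g l 0 * ((0 : ℝ) ^ l / l.factorial) = g 0 0 := by
      simp [Finset.sum_range_succ']
    rw [h0, sub_self, sub_zero, sub_zero, Real.norm_eq_abs, Real.norm_eq_abs,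
      abs_of_nonneg hτ.1] at h
    have hC0 : 0 ≤ C := (abs_nonneg _).trans (hC τ hτ)
    exact h.trans (mul_le_of_le_one_right hC0 hτ.2)

lemma sum_shuffles_singleton {d : ℕ} (l : ℕ) (S Y : List (Fin d) → ℝ)
    (hS : ∀ w w', w.Perm w' → S w = S w') :
    ∑ a, ∑ α : Fin l → Fin d,
        S (a :: List.ofFn α) * ((shuffles [a] (List.ofFn α)).map Y).sum =
      (l + 1) * ∑ α : Fin (l + 1) → Fin d, S (List.ofFn α) * Y (List.ofFn α) := by
  induction l generalizing S Y with
  | zero => simp [sum_fin_succ_fun, shuffles]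
  | succ l ih =>
    have hfirst : ∑ a, ∑ b, ∑ α : Fin l → Fin d,
        S (a :: b :: List.ofFn α) * Y (a :: b :: List.ofFn α) =
        ∑ α : Fin (l + 2) → Fin d, S (List.ofFn α) * Y (List.ofFn α) := by
      simp [sum_fin_succ_fun (l := l + 1), sum_fin_succ_fun (l := l), List.ofFn_succ]
    have hsecond : ∑ a, ∑ b, ∑ α : Fin l → Fin d, S (a :: b :: List.ofFn α) *
        ((shuffles [a] (List.ofFn α)).map fun w => Y (b :: w)).sum =
        (l + 1) * ∑ α : Fin (l + 2) → Fin d, S (List.ofFn α) * Y (List.ofFn α) := by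
      rw [Finset.sum_comm, sum_fin_succ_fun (l := l + 1), Finset.mul_sum]
      refine Finset.sum_congr rfl fun b _ => ?_
      have := ih (fun w => S (b :: w)) (fun w => Y (b :: w)) fun w w' h => hS _ _ (h.cons b)
      simp only [List.ofFn_succ (n := l + 1), Fin.cons_zero, Fin.cons_succ]
      rw [← this]
      refine Finset.sum_congr rfl fun a _ => Finset.sum_congr rfl fun α _ => ?_
      rw [hS _ _ (List.Perm.swap b a _)]
    simp only [sum_fin_succ_fun (l := l) (ι := Fin d), List.ofFn_succ (n := l), Fin.cons_zero,
      Fin.cons_succ]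
    simp only [shuffles, Multiset.map_add, Multiset.sum_add, Multiset.map_singleton,
      Multiset.sum_singleton, Multiset.map_map, Function.comp_def, mul_add,
      Finset.sum_add_distrib]
    rw [hfirst, hsecond]
    push_cast
    ring

/-- Pairing with a symmetric tensor only sees the symmetric part of a geometric element, which
is a divided power of its first level. -/
lemma factorial_mul_sum_symm {d N : ℕ} (Y : List (Fin d) → ℝ) (h0 : Y [] = 1)
    (hY : ∀ a b : List (Fin d), a.length + b.length ≤ N →
      Y a * Y b = ((shuffles a b).map Y).sum)
    (l : ℕ) (hl : l ≤ N) (S : List (Fin d) → ℝ) (hS : ∀ w w', w.Perm w' → S w = S w') :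
    (l.factorial : ℝ) * ∑ α : Fin l → Fin d, S (List.ofFn α) * Y (List.ofFn α) =
      ∑ α : Fin l → Fin d, S (List.ofFn α) * ∏ i, Y [α i] := by
  induction l generalizing S with
  | zero => simp [h0]
  | succ l ih =>
    rw [Nat.factorial_succ, Nat.cast_mul, mul_comm (_ : ℝ) (l.factorial : ℝ), mul_assoc]
    push_cast
    rw [← sum_shuffles_singleton l S Y hS, sum_fin_succ_fun, Finset.mul_sum]
    refine Finset.sum_congr rfl fun a _ => ?_
    simp only [List.ofFn_succ (n := l), Fin.cons_zero, Fin.cons_succ, Fin.prod_univ_succ]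
    calc _ = Y [a] * (l.factorial * ∑ α : Fin l → Fin d,
          S (a :: List.ofFn α) * Y (List.ofFn α)) := by
            simp only [Finset.mul_sum]
            refine Finset.sum_congr rfl fun α _ => ?_
            rw [← hY [a] _ (by simp; omega)]
            ring
      _ = _ := by
            rw [ih (by omega) (fun w => S (a :: w)) fun w w' h => hS _ _ (h.cons a),
              Finset.mul_sum]
            refine Finset.sum_congr rfl fun α _ => ?_
            ring

lemma abs_listDeriv_le {d e : ℕ} {F : (Fin d → ℝ) → Fin e → ℝ} (hF : ContDiff ℝ (⊤ : ℕ∞) F)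
    {N : ℕ} {M : ℝ} (hM : ∀ y, ‖iteratedFDeriv ℝ N F y‖ ≤ M) (k : Fin e)
    (w : List (Fin d)) (hw : w.length = N) (y : Fin d → ℝ) :
    |listDeriv (fun y => F y k) w y| ≤ M := by
  subst hw
  have hFk : ContDiff ℝ (⊤ : ℕ∞) fun y => F y k := contDiff_pi.1 hF k
  have h := (ContinuousLinearMap.proj (R := ℝ) (φ := fun _ : Fin e => ℝ) k).iteratedFDeriv_comp_left
    (hF.contDiffAt (x := y)) (i := w.length) (by exact_mod_cast le_top)
  have h' : pderivWord (fun y => F y k) w.get y =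
      iteratedFDeriv ℝ w.length F y (fun i => Pi.single (w.get i) 1) k := by
    change iteratedFDeriv ℝ w.length
      (ContinuousLinearMap.proj (R := ℝ) (φ := fun _ : Fin e => ℝ) k ∘ F) y _ = _
    rw [h]
    rfl
  have heq := pderivWord_eq_listDeriv hFk w.get y
  rw [List.ofFn_get] at heq
  rw [← heq, h', ← Real.norm_eq_abs]
  refine (norm_le_pi_norm _ k).trans ((ContinuousMultilinearMap.le_opNorm _ _).trans ?_)
  simpa [Pi.norm_single] using hM y

lemma abs_lineDerivSum_le {d : ℕ} {f : (Fin d → ℝ) → ℝ} {w : List (Fin d)} {v y : Fin d → ℝ}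
    {l : ℕ} {M ρ : ℝ} (hM : ∀ α : Fin l → Fin d, |listDeriv f (List.ofFn α ++ w) y| ≤ M)
    (hM0 : 0 ≤ M) (hv : ∀ a, |v a| ≤ ρ) : |lineDerivSum f w v l y| ≤ M * (d * ρ) ^ l := by
  calc |lineDerivSum f w v l y|
      ≤ ∑ α : Fin l → Fin d, |listDeriv f (List.ofFn α ++ w) y * ∏ i, v (α i)| :=
        Finset.abs_sum_le_sum_abs _ _
    _ ≤ ∑ _α : Fin l → Fin d, M * ρ ^ l := by
        refine Finset.sum_le_sum fun α _ => ?_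
        rw [abs_mul, Finset.abs_prod]
        refine mul_le_mul (hM α) ?_ (Finset.prod_nonneg fun _ _ => abs_nonneg _) hM0
        simpa using Finset.prod_le_prod (s := Finset.univ) (fun i _ => abs_nonneg (v (α i)))
          fun i _ => hv (α i)
    _ = M * (d * ρ) ^ l := by
        simp only [Finset.sum_const, Finset.card_univ, Fintype.card_fun, Fintype.card_fin,
          nsmul_eq_mul, Nat.cast_pow]
        ring

/-- If `F : V → U` is smooth (with bounded derivatives) and
`X` is a p-weakly geometric rough path with trace `x`, then
`(F(x_t), DF(x_t), …, D^{⌊p⌋−1}F(x_t))` is an `X`-controlled path: for every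
word `β` with `|β| ≤ ⌊p⌋−2`,
`∂_β F(x_t) − ∑_{|α| ≤ ⌊p⌋−1−|β|} ∂_{α,β}F(x_s) X^α_{s,t} = O(ω(s,t)^{(⌊p⌋−|β|)/p})`. -/
theorem smooth_function_of_trace_is_controlled
    (d e : ℕ) (p T : ℝ) (hp : 1 ≤ p) (ω : ℝ → ℝ → ℝ) (hω : IsControl ω T)
    (R : RoughPath d p T ω) (x : ℝ → Fin d → ℝ)
    (hx : ∀ s t, 0 ≤ s → s ≤ t → t ≤ T → ∀ γ : Fin d, R.X s t [γ] = x t γ - x s γ)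
    (F : (Fin d → ℝ) → Fin e → ℝ) (hF : ContDiff ℝ (⊤ : ℕ∞) F)
    (hFb : ∀ n : ℕ, ∃ M, ∀ y, ‖iteratedFDeriv ℝ n F y‖ ≤ M) :
    ∃ C, ∀ (b : ℕ) (β : Fin b → Fin d), b ≤ ⌊p⌋₊ - 2 →
      ∀ s t, 0 ≤ s → s ≤ t → t ≤ T → ∀ k,
        |pderivWord (fun y => F y k) β (x t) -
            ∑ l ∈ Finset.range (⌊p⌋₊ - b), ∑ α : Fin l → Fin d,
              pderivWord (fun y => F y k) (Fin.append α β) (x s) * R.X s t (List.ofFn α)|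
          ≤ C * ω s t ^ (((⌊p⌋₊ : ℝ) - b) / p) := by
  obtain ⟨C₀, hC₀⟩ := R.regularity
  obtain ⟨M, hM⟩ := hFb ⌊p⌋₊
  have hM0 : 0 ≤ M := (norm_nonneg _).trans (hM 0)
  have hN : 1 ≤ ⌊p⌋₊ := Nat.one_le_floor_iff p |>.2 hp
  refine ⟨M * max 1 (d * |C₀|) ^ ⌊p⌋₊, fun b β hb s t hs hst ht k => ?_⟩
  have hf : ContDiff ℝ (⊤ : ℕ∞) fun y => F y k := contDiff_pi.1 hF k
  set f : (Fin d → ℝ) → ℝ := fun y => F y k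
  set v : Fin d → ℝ := x t - x s with hv
  have hω0 : 0 ≤ ω s t := hω.2.2.1 s t
  have hvX : ∀ a, R.X s t [a] = v a := fun a => hx s t hs hst ht a
  have hvb : ∀ a, |v a| ≤ |C₀| * ω s t ^ (1 / p) := fun a => by
    have h := hC₀ [a] (by simpa using hN) s t hs hst ht
    rw [hvX] at h
    simp only [List.length_singleton, Nat.cast_one] at h
    exact h.trans (mul_le_mul_of_nonneg_right (le_abs_self _) (Real.rpow_nonneg hω0 _))
  have hterm : ∀ l ∈ Finset.range (⌊p⌋₊ - b), ∑ α : Fin l → Fin d,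
      pderivWord f (Fin.append α β) (x s) * R.X s t (List.ofFn α) =
      lineDerivSum f (List.ofFn β) v l (x s) * (1 ^ l / l.factorial) := by
    intro l hl
    have h := factorial_mul_sum_symm (N := ⌊p⌋₊) (R.X s t) (R.empty_eq s t)
      (R.shuffle_rel s t hs hst ht) l (by have := Finset.mem_range.1 hl; omega)
      (fun w => listDeriv f (w ++ List.ofFn β) (x s))
      fun w w' hw => by rw [listDeriv_perm hf (hw.append_right _)]
    simp only [hvX] at h
    simp only [pderivWord_eq_listDeriv hf, List.ofFn_fin_append, lineDerivSum]
    have := Nat.factorial_ne_zero l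
    rw [← h]
    field_simp
    simp
  have hline : ∀ y, |lineDerivSum f (List.ofFn β) v (⌊p⌋₊ - b) y| ≤
      M * (d * (|C₀| * ω s t ^ (1 / p))) ^ (⌊p⌋₊ - b) := fun y =>
    abs_lineDerivSum_le (fun α => abs_listDeriv_le hF hM k _ (by simp; omega) y) hM0 hvb
  have htaylor := abs_sub_taylor_sum_le (⌊p⌋₊ - b)
    (fun l τ => lineDerivSum f (List.ofFn β) v l (x s + τ • v))
    (fun l τ => hasDerivAt_lineDerivSum hf _ _ _ l τ) (fun τ _ => hline _) 1 (by simp)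
  have hzero : lineDerivSum f (List.ofFn β) v 0 (x t) = pderivWord f β (x t) := by
    simp [lineDerivSum, pderivWord_eq_listDeriv hf]
  have hend : x s + v = x t := by simp [hv]
  simp only [one_smul, zero_smul, add_zero, hend, hzero] at htaylor
  rw [Finset.sum_congr rfl hterm]
  refine htaylor.trans ?_
  have hpow : (ω s t ^ (1 / p)) ^ (⌊p⌋₊ - b) = ω s t ^ (((⌊p⌋₊ : ℝ) - b) / p) := by
    rw [← Real.rpow_natCast, ← Real.rpow_mul hω0, Nat.cast_sub (by omega)]
    congr 1
    ring
  rw [← mul_assoc (d : ℝ), mul_pow, hpow, ← mul_assoc]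
  refine mul_le_mul_of_nonneg_right ?_ (Real.rpow_nonneg hω0 _)
  refine mul_le_mul_of_nonneg_left ?_ hM0
  exact (pow_le_pow_left₀ (by positivity) (le_max_right _ _) _).trans
    (pow_le_pow_right₀ (le_max_left _ _) (Nat.sub_le _ _))
end

section
/- Change of variables for rough paths: if F ∈ C^∞(V,W) and X is a p-weakly geometric rough path with trace X, then F(X)_t = F(X_0) + ∫_0^t DF(X) dX, i.e., the trace of the pushforward F_*X equals F(X_0) plus the rough integral of the controlled 1-form DF(X) against X. -/
open scoped Nat Topology

/-- The iterated partial derivative of `f` along the coordinate directions listed in a word. -/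
noncomputable def pderivList {d : ℕ} (f : (Fin d → ℝ) → ℝ) :
    List (Fin d) → (Fin d → ℝ) → ℝ
  | [] => f
  | a :: l => fun x => fderiv ℝ (pderivList f l) x (Pi.single a 1)

theorem contDiff_pderivList {d : ℕ} {f : (Fin d → ℝ) → ℝ} (hf : ContDiff ℝ (⊤ : ℕ∞) f)
    (l : List (Fin d)) : ContDiff ℝ (⊤ : ℕ∞) (pderivList f l) := by
  induction l with
  | nil => exact hf
  | cons a l ih => exact (ih.fderiv_right (m := (⊤ : ℕ∞)) (by simp)).clm_apply contDiff_const

theorem pderivList_perm {d : ℕ} {f : (Fin d → ℝ) → ℝ} (hf : ContDiff ℝ (⊤ : ℕ∞) f)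
    {l l' : List (Fin d)} (h : l.Perm l') : pderivList f l = pderivList f l' := by
  induction h with
  | nil => rfl
  | cons a _ ih => simp only [pderivList, ih]
  | swap a b l =>
    funext x
    have hg := contDiff_pderivList hf l
    have hd : DifferentiableAt ℝ (fderiv ℝ (pderivList f l)) x :=
      (hg.fderiv_right (m := 1) (by norm_cast)).differentiable (by simp) x
    have hsymm : IsSymmSndFDerivAt ℝ (pderivList f l) x :=
      hg.contDiffAt.isSymmSndFDerivAt (by simp; norm_cast)
    have key (c : Fin d → ℝ) (e : Fin d → ℝ) :
        fderiv ℝ (fun y => fderiv ℝ (pderivList f l) y c) x e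
          = fderiv ℝ (fderiv ℝ (pderivList f l)) x e c := by
      rw [fderiv_clm_apply hd (differentiableAt_const c)]
      simp
    simp only [pderivList, key]
    exact hsymm _ _
  | trans _ _ ih₁ ih₂ => exact ih₁.trans ih₂

theorem pderivWord_eq_pderivList {d : ℕ} {f : (Fin d → ℝ) → ℝ} (hf : ContDiff ℝ (⊤ : ℕ∞) f) {n : ℕ}
    (w : Fin n → Fin d) (x : Fin d → ℝ) :
    pderivWord f w x = pderivList f (List.ofFn w) x := by
  induction n generalizing x with
  | zero => simp [pderivWord, pderivList]
  | succ n ih =>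
    have hd : DifferentiableAt ℝ (iteratedFDeriv ℝ n f) x :=
      hf.differentiable_iteratedFDeriv (by exact_mod_cast WithTop.coe_lt_top _) x
    rw [List.ofFn_succ, pderivList, pderivWord, hd.iteratedFDeriv_succ_apply_left']
    congr 2
    funext y
    exact ih (fun i => w i.succ) y

theorem shuffles_nil_left {α : Type*} (l : List α) : shuffles [] l = {l} := by
  rw [shuffles]

theorem sum_map_shuffles_singleton {α : Type*} (a : α) {n : ℕ} (w : Fin n → α)
    (f : List α → ℝ) :
    ((shuffles [a] (List.ofFn w)).map f).sum
      = ∑ i : Fin (n + 1), f (List.ofFn (i.insertNth a w : Fin (n + 1) → α)) := by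
  induction n generalizing f with
  | zero => simp [shuffles]
  | succ n ih =>
    obtain ⟨b, v, rfl⟩ : ∃ b v, w = Fin.cons b v := ⟨w 0, Fin.tail w, by simp⟩
    rw [List.ofFn_cons, shuffles, shuffles_nil_left, Fin.sum_univ_succ]
    simp only [Multiset.map_add, Multiset.sum_add, Multiset.map_map, Function.comp_def,
      Multiset.map_singleton, Multiset.sum_singleton, Fin.insertNth_succ_cons,
      Fin.insertNth_zero', List.ofFn_cons]
    rw [ih v (fun l => f (b :: l))]

theorem ofFn_insertNth_perm {α : Type*} {n : ℕ} (i : Fin (n + 1)) (a : α) (w : Fin n → α) :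
    (List.ofFn (i.insertNth a w : Fin (n + 1) → α)).Perm (a :: List.ofFn w) := by
  rw [← Fin.cons_comp_cycleRange, ← List.ofFn_cons]
  exact Equiv.Perm.ofFn_comp_perm _ _

/-- `n! • Sym(X^n) = (X^1)^{⊗ n}`, tested against a symmetric function `g` of words. -/
theorem sum_mul_prod_eq_factorial_mul_sum {α : Type*} [Fintype α] {N : ℕ}
    {X : List α → ℝ} (hX : X [] = 1)
    (hsh : ∀ a b : List α, a.length + b.length ≤ N →
      X a * X b = ((shuffles a b).map X).sum)
    {n : ℕ} (hn : n ≤ N) {g : List α → ℝ} (hg : ∀ l l' : List α, l.Perm l' → g l = g l') :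
    ∑ v : Fin n → α, g (List.ofFn v) * ∏ i, X [v i]
      = n ! * ∑ v : Fin n → α, g (List.ofFn v) * X (List.ofFn v) := by
  induction n generalizing g with
  | zero => simp [hX]
  | succ n ih =>
    have hins (i : Fin (n + 1)) :
        ∑ a : α, ∑ w : Fin n → α,
          g (a :: List.ofFn w) * X (List.ofFn (i.insertNth a w : Fin (n + 1) → α))
          = ∑ v : Fin (n + 1) → α, g (List.ofFn v) * X (List.ofFn v) := by
      rw [← (Fin.insertNthEquiv (fun _ => α) i).sum_comp, Fintype.sum_prod_type]
      refine Finset.sum_congr rfl fun a _ => Finset.sum_congr rfl fun w _ => ?_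
      change _ = g (List.ofFn (i.insertNth a w : Fin (n + 1) → α)) * _
      rw [hg _ _ (ofFn_insertNth_perm i a w)]
      rfl
    calc ∑ v : Fin (n + 1) → α, g (List.ofFn v) * ∏ i, X [v i]
        = ∑ a : α, X [a] * ∑ w : Fin n → α, g (a :: List.ofFn w) * ∏ i, X [w i] := by
          rw [← (Fin.consEquiv (fun _ => α)).sum_comp, Fintype.sum_prod_type]
          refine Finset.sum_congr rfl fun a _ => ?_
          rw [Finset.mul_sum]
          refine Finset.sum_congr rfl fun w _ => ?_
          change g (List.ofFn (Fin.cons a w : Fin (n + 1) → α)) *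
            ∏ i, X [(Fin.cons a w : Fin (n + 1) → α) i] = _
          simp only [List.ofFn_cons, Fin.prod_univ_succ, Fin.cons_zero,
            Fin.cons_succ]
          ring
      _ = ∑ a : α, X [a] * (n ! * ∑ w : Fin n → α, g (a :: List.ofFn w) * X (List.ofFn w)) := by
          refine Finset.sum_congr rfl fun a _ => ?_
          rw [ih (by omega) (g := fun l => g (a :: l)) fun l l' h => hg _ _ (h.cons a)]
      _ = n ! * ∑ a : α, ∑ w : Fin n → α,
            g (a :: List.ofFn w) * (X [a] * X (List.ofFn w)) := by
          simp only [Finset.mul_sum]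
          exact Finset.sum_congr rfl fun a _ => Finset.sum_congr rfl fun w _ => by ring
      _ = n ! * ∑ i : Fin (n + 1), ∑ a : α, ∑ w : Fin n → α,
            g (a :: List.ofFn w) * X (List.ofFn (i.insertNth a w : Fin (n + 1) → α)) := by
          congr 1
          conv_rhs => rw [Finset.sum_comm]
          refine Finset.sum_congr rfl fun a _ => ?_
          rw [Finset.sum_comm]
          refine Finset.sum_congr rfl fun w _ => ?_
          rw [hsh _ _ (by simp; omega), sum_map_shuffles_singleton, Finset.mul_sum]
      _ = (n + 1)! * ∑ v : Fin (n + 1) → α, g (List.ofFn v) * X (List.ofFn v) := by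
          simp only [hins, Finset.sum_const, Finset.card_univ, Fintype.card_fin, nsmul_eq_mul,
            Nat.factorial_succ]
          push_cast
          ring

theorem iteratedFDeriv_apply_const_eq_sum {d : ℕ} (f : (Fin d → ℝ) → ℝ) (n : ℕ)
    (x h : Fin d → ℝ) :
    iteratedFDeriv ℝ n f x (fun _ => h)
      = ∑ v : Fin n → Fin d, pderivWord f v x * ∏ i, h (v i) := by
  have hh : h = ∑ j, h j • (Pi.single j 1 : Fin d → ℝ) := by
    ext i; simp [Finset.sum_apply, Pi.single_apply]
  conv_lhs => rw [hh]
  rw [ContinuousMultilinearMap.map_sum]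
  refine Finset.sum_congr rfl fun v _ => ?_
  rw [ContinuousMultilinearMap.map_smul_univ, smul_eq_mul, mul_comm, pderivWord]

theorem norm_taylor_remainder_le {E : Type*} [NormedAddCommGroup E] [NormedSpace ℝ E]
    {f : E → ℝ} {n : ℕ} (hf : ContDiff ℝ (n + 1) f) {M : ℝ}
    (hM : ∀ y m, ‖iteratedFDeriv ℝ (n + 1) f y m‖ ≤ M * ∏ i, ‖m i‖) (x h : E) :
    |f (x + h) - ∑ k ∈ Finset.range (n + 1), (k ! : ℝ)⁻¹ * iteratedFDeriv ℝ k f x (fun _ => h)|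
      ≤ M * ‖h‖ ^ (n + 1) := by
  have hb (m : Fin (n + 1) → E) : 0 ≤ M * ∏ i, ‖m i‖ := (norm_nonneg _).trans (hM x m)
  have hint : ‖∫ t in (0 : ℝ)..1, (1 - t) ^ n •
      iteratedFDeriv ℝ (n + 1) f (x + t • h) (fun _ => h)‖ ≤ M * ‖h‖ ^ (n + 1) * |1 - 0| := by
    refine intervalIntegral.norm_integral_le_of_norm_le_const fun t ht => ?_
    rw [Set.uIoc_of_le zero_le_one] at ht
    have h1 : ‖(1 - t) ^ n‖ ≤ 1 := by
      rw [norm_pow, Real.norm_of_nonneg (by linarith [ht.2])]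
      exact pow_le_one₀ (by linarith [ht.2]) (by linarith [ht.1])
    have h2 := hM (x + t • h) fun _ => h
    simp only [Finset.prod_const, Finset.card_univ, Fintype.card_fin] at h2
    rw [norm_smul]
    exact (mul_le_of_le_one_left (norm_nonneg _) h1).trans h2
  have hfac : ‖(n ! : ℝ)⁻¹‖ ≤ 1 := by
    rw [norm_inv, Real.norm_natCast]
    exact inv_le_one_of_one_le₀ (by exact_mod_cast Nat.factorial_pos n)
  rw [map_add_eq_sum_add_integral_iteratedFDeriv (n := n) fun t _ => hf.contDiffAt]
  simp only [smul_eq_mul] at hint ⊢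
  rw [add_sub_cancel_left, ← Real.norm_eq_abs, norm_mul]
  exact (mul_le_of_le_one_left (norm_nonneg _) hfac).trans (by simpa using hint)

/-- A continuous path whose increments are controlled by `ω ^ θ` with `θ > 1` is constant. -/
theorem IsControl.eq_of_abs_sub_le_rpow {ω : ℝ → ℝ → ℝ} {T : ℝ} (hω : IsControl ω T)
    {G : ℝ → ℝ} (hG : ContinuousOn G (Set.Icc 0 T)) {C θ : ℝ} (hθ : 1 < θ)
    (hC : ∀ s t, 0 ≤ s → s ≤ t → t ≤ T → |G t - G s| ≤ C * ω s t ^ θ) :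
    ∀ t ∈ Set.Icc 0 T, G t = G 0 := by
  obtain ⟨hcont, hdiag, hnn, hsuper⟩ := hω
  intro t ht
  have hε : ∀ ε > 0, |G t - G 0| ≤ ε * ω 0 t := by
    intro ε hε
    have hsub : Set.Icc 0 T ⊆ {r | |G r - G 0| ≤ ε * ω 0 r} := by
      refine IsClosed.Icc_subset_of_forall_mem_nhdsWithin ?_ ?_ ?_
      · rw [Set.inter_comm]
        have h0 : Continuous fun r => ω 0 r :=
          hcont.comp (continuous_const.prodMk continuous_id)
        have hd : ContinuousOn (fun r => |G r - G 0| - ε * ω 0 r) (Set.Icc 0 T) :=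
          ((hG.sub continuousOn_const).abs).sub (by fun_prop)
        convert hd.preimage_isClosed_of_isClosed isClosed_Icc (isClosed_Iic (a := 0)) using 2
        ext r
        simp
      · simp [hdiag]
      · rintro r ⟨hr, hr0, hrT⟩
        have hlim : Filter.Tendsto (fun u => |C| * ω r u ^ (θ - 1)) (𝓝[>] r) (𝓝 0) := by
          have h1 : Continuous fun u => |C| * ω r u ^ (θ - 1) :=
            continuous_const.mul ((hcont.comp (continuous_const.prodMk continuous_id)).rpow_const
              fun _ => Or.inr (by linarith))
          have h2 := (h1.tendsto r).mono_left (nhdsWithin_le_nhds (s := Set.Ioi r))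
          simpa [hdiag, Real.zero_rpow (show θ - 1 ≠ 0 by linarith)] using h2
        filter_upwards [hlim.eventually_lt_const hε, Ioo_mem_nhdsGT hrT] with u hu hru
        have hstep : |G u - G r| ≤ ε * ω r u := by
          calc |G u - G r| ≤ C * ω r u ^ θ := hC r u hr0 hru.1.le hru.2.le
            _ ≤ |C| * ω r u ^ θ := by
              gcongr
              · exact Real.rpow_nonneg (hnn _ _) _
              · exact le_abs_self C
            _ = |C| * ω r u ^ (θ - 1) * ω r u := by
              rw [mul_assoc, ← Real.rpow_add_one' (hnn _ _) (by linarith), sub_add_cancel]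
            _ ≤ ε * ω r u := mul_le_mul_of_nonneg_right hu.le (hnn _ _)
        have hsum := mul_le_mul_of_nonneg_left
          (hsuper 0 r u le_rfl hr0 hru.1.le hru.2.le) hε.le
        simp only [Set.mem_ofPred_eq] at hr ⊢
        linarith [abs_sub_le (G u) (G r) (G 0)]
    exact hsub ht
  have hzero : |G t - G 0| ≤ 0 := by
    have hlim : Filter.Tendsto (fun ε : ℝ => ε * ω 0 t) (𝓝[>] 0) (𝓝 0) := by
      have h1 : Continuous fun ε : ℝ => ε * ω 0 t := by fun_prop
      simpa using (h1.tendsto 0).mono_left (nhdsWithin_le_nhds (s := Set.Ioi 0))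
    exact ge_of_tendsto hlim (Filter.eventually_of_mem self_mem_nhdsWithin hε)
  exact sub_eq_zero.1 (abs_eq_zero.1 (le_antisymm hzero (abs_nonneg _)))

theorem RoughPath.continuousOn_trace {d : ℕ} {p T : ℝ} {ω : ℝ → ℝ → ℝ}
    (R : RoughPath d p T ω) {x : ℝ → Fin d → ℝ}
    (hx : ∀ s t, 0 ≤ s → s ≤ t → t ≤ T → ∀ γ : Fin d, R.X s t [γ] = x t γ - x s γ) :
    ContinuousOn x (Set.Icc 0 T) := by
  refine continuousOn_pi.2 fun γ => ?_
  have hc : Continuous fun t => R.X 0 t [γ] + x 0 γ :=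
    ((R.cont [γ]).comp (continuous_const.prodMk continuous_id)).add continuous_const
  exact hc.continuousOn.congr fun t ht => by
    simp [hx 0 t le_rfl ht.1 ht.2 γ]

theorem RoughPath.exists_norm_trace_sub_le {d : ℕ} {p T : ℝ} (hp : 1 ≤ p) {ω : ℝ → ℝ → ℝ}
    (hω : IsControl ω T) (R : RoughPath d p T ω) {x : ℝ → Fin d → ℝ}
    (hx : ∀ s t, 0 ≤ s → s ≤ t → t ≤ T → ∀ γ : Fin d, R.X s t [γ] = x t γ - x s γ) :
    ∃ C, ∀ s t, 0 ≤ s → s ≤ t → t ≤ T → ‖x t - x s‖ ≤ C * ω s t ^ (1 / p) := by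
  obtain ⟨C, hC⟩ := R.regularity
  refine ⟨|C|, fun s t hs hst ht => ?_⟩
  have hr := Real.rpow_nonneg (hω.2.2.1 s t) (1 / p)
  refine (pi_norm_le_iff_of_nonneg (by positivity)).2 fun γ => ?_
  have h := hC [γ] (Nat.le_floor (by simpa using hp)) s t hs hst ht
  simp only [hx s t hs hst ht γ, List.length_singleton, Nat.cast_one] at h
  exact h.trans (mul_le_mul_of_nonneg_right (le_abs_self C) hr)

/-- For a weakly geometric rough path, the local approximant of `∫ Df(x) dX` is the Taylor
polynomial of the increment of `f` along the trace. -/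
theorem RoughPath.sum_pderivWord_mul_eq {d : ℕ} {p T : ℝ} {ω : ℝ → ℝ → ℝ}
    (R : RoughPath d p T ω) {x : ℝ → Fin d → ℝ}
    (hx : ∀ s t, 0 ≤ s → s ≤ t → t ≤ T → ∀ γ : Fin d, R.X s t [γ] = x t γ - x s γ)
    {f : (Fin d → ℝ) → ℝ} (hf : ContDiff ℝ (⊤ : ℕ∞) f)
    {s t : ℝ} (hs : 0 ≤ s) (hst : s ≤ t) (ht : t ≤ T) {l : ℕ} (hl : l ≤ ⌊p⌋₊) :
    ∑ v : Fin l → Fin d, pderivWord f v (x s) * R.X s t (List.ofFn v)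
      = (l ! : ℝ)⁻¹ * iteratedFDeriv ℝ l f (x s) (fun _ => x t - x s) := by
  have h := sum_mul_prod_eq_factorial_mul_sum (R.empty_eq s t)
    (R.shuffle_rel s t hs hst ht) hl (g := fun w => pderivList f w (x s))
    fun w w' hw => by rw [pderivList_perm hf hw]
  simp only [← pderivWord_eq_pderivList hf, hx s t hs hst ht] at h
  rw [iteratedFDeriv_apply_const_eq_sum]
  simp only [Pi.sub_apply]
  rw [h, inv_mul_cancel_left₀ (by positivity)]

/-- **change of variables.** If `F` is smooth and `X` a
p-weakly geometric rough path with trace `x`, then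
`F(x_t) = F(x_0) + ∫₀ᵗ DF(x) dX`: any path `I` with `I_0 = 0` satisfying the
defining sewing property of the rough integral of the controlled 1-form
`DF(x)` (whose local approximant is `Ξ_{s,t} = ∑_{1≤|γ|≤⌊p⌋} ∂_γF(x_s) X^γ_{s,t}`)
satisfies `F(x_t) = F(x_0) + I_t` on `[0,T]`. -/
theorem change_of_variables_roughPath
    (d e : ℕ) (p T : ℝ) (hp : 1 ≤ p) (ω : ℝ → ℝ → ℝ) (hω : IsControl ω T)
    (R : RoughPath d p T ω) (x : ℝ → Fin d → ℝ)
    (hx : ∀ s t, 0 ≤ s → s ≤ t → t ≤ T → ∀ γ : Fin d, R.X s t [γ] = x t γ - x s γ)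
    (F : (Fin d → ℝ) → Fin e → ℝ) (hF : ContDiff ℝ (⊤ : ℕ∞) F)
    (hFb : ∀ n : ℕ, ∃ M, ∀ y, ‖iteratedFDeriv ℝ n F y‖ ≤ M)
    (I : ℝ → Fin e → ℝ) (hI0 : ∀ k, I 0 k = 0)
    (hIcont : ∀ k, Continuous fun t => I t k)
    (hI : ∃ C, ∀ s t, 0 ≤ s → s ≤ t → t ≤ T → ∀ k,
      |I t k - I s k -
          ∑ l ∈ Finset.Icc 1 ⌊p⌋₊, ∑ v : Fin l → Fin d,
            pderivWord (fun y => F y k) v (x s) * R.X s t (List.ofFn v)|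
        ≤ C * ω s t ^ (((⌊p⌋₊ : ℝ) + 1) / p)) :
    ∀ t, 0 ≤ t → t ≤ T → ∀ k, F (x t) k = F (x 0) k + I t k := by
  intro t ht0 htT k
  set f : (Fin d → ℝ) → ℝ := fun y => F y k
  have hf : ContDiff ℝ (⊤ : ℕ∞) f := contDiff_pi.1 hF k
  set n := ⌊p⌋₊
  obtain ⟨M, hM⟩ := hFb (n + 1)
  obtain ⟨C, hC⟩ := hI
  obtain ⟨K, hK⟩ := R.exists_norm_trace_sub_le hp hω hx
  have hfM : ∀ y m, ‖iteratedFDeriv ℝ (n + 1) f y m‖ ≤ M * ∏ i, ‖m i‖ := by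
    intro y m
    have hcomp :=
      (ContinuousLinearMap.proj k : (Fin e → ℝ) →L[ℝ] ℝ).iteratedFDeriv_comp_left
        (hF.contDiffAt (x := y)) (i := n + 1) (by exact_mod_cast le_top)
    have hval : iteratedFDeriv ℝ (n + 1) f y m = iteratedFDeriv ℝ (n + 1) F y m k :=
      congrArg (fun A => A m) hcomp
    rw [hval]
    exact (norm_le_pi_norm _ k).trans
      (((iteratedFDeriv ℝ (n + 1) F y).le_opNorm m).trans (by gcongr; exact hM y))
  have hM0 : 0 ≤ M := (norm_nonneg _).trans (hM 0)
  have hθ : 1 < ((n : ℝ) + 1) / p := by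
    rw [one_lt_div (by linarith)]
    exact Nat.lt_floor_add_one p
  have hGcont : ContinuousOn (fun r => f (x r) - I r k) (Set.Icc 0 T) :=
    (hf.continuous.comp_continuousOn (R.continuousOn_trace hx)).sub (hIcont k).continuousOn
  have hG : ∀ s r, 0 ≤ s → s ≤ r → r ≤ T →
      |(f (x r) - I r k) - (f (x s) - I s k)|
        ≤ (M * K ^ (n + 1) + C) * ω s r ^ (((n : ℝ) + 1) / p) := by
    intro s r hs hsr hr
    have htay := norm_taylor_remainder_le (n := n) (hf.of_le (by exact_mod_cast le_top)) hfM
      (x s) (x r - x s)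
    have hbound : ‖x r - x s‖ ^ (n + 1) ≤ K ^ (n + 1) * ω s r ^ (((n : ℝ) + 1) / p) := by
      refine (pow_le_pow_left₀ (norm_nonneg _) (hK s r hs hsr hr) (n + 1)).trans_eq ?_
      rw [mul_pow, ← Real.rpow_mul_natCast (hω.2.2.1 s r)]
      congr 2
      push_cast
      ring
    have hlocal := hC s r hs hsr hr k
    rw [Finset.sum_congr rfl fun l hl => R.sum_pderivWord_mul_eq hx hf hs hsr hr
      (Finset.mem_Icc.1 hl).2] at hlocal
    rw [Finset.range_eq_Ico, Finset.sum_eq_sum_Ico_succ_bot (Nat.succ_pos n), add_sub_cancel]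
      at htay
    change |I r k - I s k - ∑ l ∈ Finset.Ico 1 (n + 1), _| ≤ _ at hlocal
    simp only [Nat.factorial_zero, Nat.cast_one, inv_one, one_mul, iteratedFDeriv_zero_apply,
      zero_add] at htay
    rw [add_mul, mul_assoc]
    have h1 := htay.trans (mul_le_mul_of_nonneg_left hbound hM0)
    rw [abs_le] at h1 hlocal ⊢
    constructor <;> linarith [h1.1, h1.2, hlocal.1, hlocal.2]
  have hconst := hω.eq_of_abs_sub_le_rpow hGcont hθ hG t ⟨ht0, htT⟩
  simp only [hI0, sub_zero] at hconst
  linarith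
end

section
/- Change of controlling rough path: let H̄ ∈ D_X(U), let H = ↑_X H̄ be its rough path lift, and let K̄ ∈ D_H(S) be a path controlled by H. Then the composite K̄ * H̄, defined at level n by (K̄*H̄)_n = Σ_{m=1}^n K̄_m ∘ H̄^{⊠m} ∘ Δ̃_{OSh}^m restricted to V^{⊗n} (and (K̄*H̄)_0 = K̄_0), is an X-controlled path in D_X(S). -/
/-- Half (ordered) shuffle of two words: the shuffles in which the last letter
of the second word stays last.  Convention: `osh2 a [] = 0`, `osh2 [] b = {b}`. -/
def osh2 {α : Type*} (a b : List α) : Multiset (List α) :=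
  match b.getLast? with
  | none => 0
  | some x => (shuffles a b.dropLast).map (· ++ [x])

/-- Multiset of ordered shuffles of a list of words. -/
def oshMany {α : Type*} (ws : List (List α)) : Multiset (List α) :=
  ws.foldl (fun acc w => acc.bind fun u => osh2 u w) {([] : List α)}

/-- Bounded words: words over `Fin d` of length at most `N`. -/
abbrev BWord (d N : ℕ) := Σ l : Fin (N + 1), Fin (l : ℕ) → Fin d

/-- The word (list) underlying a bounded word. -/
def bwList {d N : ℕ} (g : BWord d N) : List (Fin d) := List.ofFn g.2

/-- A path `H` controlled by the rough path (coordinates) `X`: it is valued in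
`L(T^{⌊p⌋−1}(V), U)` (so truncated at level `⌊p⌋−1`), continuous, each level
is `ω^{1/p}`-regular, and the Gubinelli compatibility estimates hold:
for `|β| ≤ ⌊p⌋−2`,
`H_t^β − ∑_{|α| ≤ ⌊p⌋−1−|β|} H_s^{αβ} X_{s,t}^α = O(ω(s,t)^{(⌊p⌋−|β|)/p})`. -/
def IsControlledPath (d : ℕ) {ι : Type*} (p T : ℝ) (ω : ℝ → ℝ → ℝ)
    (X : ℝ → ℝ → List (Fin d) → ℝ) (H : ℝ → List (Fin d) → ι → ℝ) : Prop :=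
  (∀ t (w : List (Fin d)) k, ⌊p⌋₊ - 1 < w.length → H t w k = 0) ∧
  (∀ w k, Continuous fun t => H t w k) ∧
  (∃ C, ∀ w : List (Fin d), w.length ≤ ⌊p⌋₊ - 1 →
    ∀ s t, 0 ≤ s → s ≤ t → t ≤ T → ∀ k,
      |H t w k - H s w k| ≤ C * ω s t ^ (1 / p)) ∧
  (∃ C, ∀ (b : ℕ) (β : Fin b → Fin d), b ≤ ⌊p⌋₊ - 2 →
    ∀ s t, 0 ≤ s → s ≤ t → t ≤ T → ∀ k,
      |H t (List.ofFn β) k -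
          ∑ l ∈ Finset.range (⌊p⌋₊ - b), ∑ α : Fin l → Fin d,
            H s (List.ofFn α ++ List.ofFn β) k * X s t (List.ofFn α)|
        ≤ C * ω s t ^ (((⌊p⌋₊ : ℝ) - b) / p))

/-- The lift approximant `↾_X H̄` of a controlled path: `(↾_X H̄)⁰ = 1`,
`(↾_X H̄)¹_{s,t} = H_{s,t}`, and for `m ≥ 2`,
`(↾_X H̄)^m_{s,t} = ⟨H̄_s^{⊠m}, Δ̃_{OSh}^m X_{s,t}⟩`, i.e. in coordinates the
sum over tuples of nonempty words `γ¹,…,γᵐ` of total length ≤ N of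
`H_s^{γ¹}(k₁)⋯H_s^{γᵐ}(k_m) · ∑_{γ ∈ OSh(γ¹,…,γᵐ)} X_{s,t}^γ`. -/
noncomputable def liftApprox (d : ℕ) {ι : Type*} (N : ℕ)
    (X : ℝ → ℝ → List (Fin d) → ℝ) (H : ℝ → List (Fin d) → ι → ℝ)
    (s t : ℝ) : List ι → ℝ
  | [] => 1
  | [k] => H t [] k - H s [] k
  | k1 :: k2 :: ks =>
      ∑ g : Fin (k1 :: k2 :: ks).length → BWord d N,
        if (∀ i, 1 ≤ ((g i).1 : ℕ)) ∧ (∑ i, ((g i).1 : ℕ)) ≤ N then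
          (∏ i, H s (bwList (g i)) ((k1 :: k2 :: ks).get i)) *
            ((oshMany (List.ofFn fun i => bwList (g i))).map (X s t)).sum
        else 0

/-- Change of controlling rough path `K̄ * H̄`, in coordinates:
`(K̄*H̄)^c_γ = Σ_{m, (γ¹,…,γᵐ) ∈ OSh⁻¹(γ), γⁱ ≠ ∅} K^c_{(k₁…k_m)} H^{k₁}_{γ¹} ⋯ H^{k_m}_{γᵐ}`
(with the multiplicity of `γ` in `OSh(γ¹,…,γᵐ)`), `(K̄*H̄)^c_∅ = K^c_∅`,
truncated above level `N`. -/
noncomputable def starComp (d e f N : ℕ) (K : ℝ → List (Fin e) → Fin f → ℝ)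
    (H : ℝ → List (Fin d) → Fin e → ℝ) (s : ℝ) (γ : List (Fin d)) (c : Fin f) : ℝ :=
  if N < γ.length then 0
  else if γ = [] then K s [] c
  else
    ∑ m ∈ Finset.Icc 1 γ.length, ∑ g : Fin m → BWord d N,
      ((oshMany (List.ofFn fun i => bwList (g i))).count γ : ℝ) *
        ∑ ks : Fin m → Fin e, K s (List.ofFn ks) c * ∏ i, H s (bwList (g i)) (ks i)

/-- Multiset of all ways of writing a word as a shuffle of an ordered pair of words. -/
def unshuffles {α : Type*} : List α → Multiset (List α × List α)
  | [] => {([], [])}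
  | a :: w => (unshuffles w).map (fun q => (a :: q.1, q.2)) +
      (unshuffles w).map (fun q => (q.1, a :: q.2))

theorem length_of_mem_unshuffles {α : Type*} {w : List α} {q : List α × List α}
    (h : q ∈ unshuffles w) : q.1.length + q.2.length = w.length := by
  induction w generalizing q with
  | nil => simp_all [unshuffles]
  | cons a w ih =>
    simp only [unshuffles, Multiset.mem_add, Multiset.mem_map] at h
    rcases h with ⟨r, hr, rfl⟩ | ⟨r, hr, rfl⟩ <;> have := ih hr <;> simp <;> omega

theorem count_shuffles {α : Type*} [DecidableEq α] (u v w : List α) :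
    (shuffles u v).count w = (unshuffles w).count (u, v) := by
  have h1 : ∀ (a : α) (w u' v' : List α),
      ((unshuffles w).map (fun q => (a :: q.1, q.2))).count (a :: u', v') =
        (unshuffles w).count (u', v') := fun a w u' v' =>
    Multiset.count_map_eq_count' (fun q : List α × List α => (a :: q.1, q.2)) _
      (fun x y h => by simpa [Prod.ext_iff] using h) (u', v')
  have h2 : ∀ (a : α) (w u' v' : List α),
      ((unshuffles w).map (fun q => (q.1, a :: q.2))).count (u', a :: v') =
        (unshuffles w).count (u', v') := fun a w u' v' =>
    Multiset.count_map_eq_count' (fun q : List α × List α => (q.1, a :: q.2)) _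
      (fun x y h => by simpa [Prod.ext_iff] using h) (u', v')
  have h3 : ∀ (a : α) (s : Multiset (List α)) (w : List α),
      (s.map (a :: ·)).count (a :: w) = s.count w := fun a s w =>
    Multiset.count_map_eq_count' (a :: ·) _ (List.cons_injective) w
  have h4 : ∀ (a b : α) (s : Multiset (List α)) (w : List α), a ≠ b →
      (s.map (b :: ·)).count (a :: w) = 0 := fun a b s w hab =>
    Multiset.count_eq_zero.2 (by simp [Ne.symm hab])
  have h5 : ∀ (a b : α) (w u' v' : List α), a ≠ b →
      ((unshuffles w).map (fun q => (a :: q.1, q.2))).count (b :: u', v') = 0 :=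
    fun a b w u' v' hab => Multiset.count_eq_zero.2 (by simp [hab])
  have h6 : ∀ (a b : α) (w u' v' : List α), a ≠ b →
      ((unshuffles w).map (fun q => (q.1, a :: q.2))).count (u', b :: v') = 0 :=
    fun a b w u' v' hab => Multiset.count_eq_zero.2 (by simp [hab])
  have h7 : ∀ (a : α) (w v' : List α),
      ((unshuffles w).map (fun q => (a :: q.1, q.2))).count ([], v') = 0 :=
    fun a w v' => Multiset.count_eq_zero.2 (by simp)
  have h8 : ∀ (a : α) (w u' : List α),
      ((unshuffles w).map (fun q => (q.1, a :: q.2))).count (u', []) = 0 :=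
    fun a w u' => Multiset.count_eq_zero.2 (by simp)
  induction w generalizing u v with
  | nil =>
    cases u <;> cases v <;> simp [shuffles, unshuffles]
  | cons a w ih =>
    rcases u with _ | ⟨b, u⟩ <;> rcases v with _ | ⟨c, v⟩
    · simp [shuffles, unshuffles]
    · by_cases hc : a = c
      · subst hc
        have := ih [] v
        simp only [unshuffles, Multiset.count_add, h7, h2, ← this]
        simp [shuffles, Multiset.count_singleton]
      · simp [shuffles, unshuffles, hc]
    · by_cases hb : a = b
      · subst hb
        have := ih u []
        simp only [unshuffles, Multiset.count_add, h8, h1, ← this]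
        cases u <;> simp [shuffles, Multiset.count_singleton]
      · simp [shuffles, unshuffles, hb]
    · by_cases hb : a = b <;> by_cases hc : a = c
      · subst hb; subst hc
        simp [shuffles, unshuffles, h1, h2, h3, ih]
      · subst hb
        simp [shuffles, unshuffles, h1, h3, h4, hc, ih]
      · subst hc
        simp [shuffles, unshuffles, h2, h3, h4, hb, ih]
      · simp [shuffles, unshuffles, h4, hb, hc]

theorem length_of_mem_shuffles {α : Type*} {u v w : List α} (h : w ∈ shuffles u v) :
    w.length = u.length + v.length := by
  classical
  rw [← Multiset.count_pos, count_shuffles, Multiset.count_pos] at h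
  exact (length_of_mem_unshuffles h).symm

/-- Shuffle product of two functions on words. -/
def shuffleMul {α A : Type*} [CommRing A] (F G : List α → A) (w : List α) : A :=
  ((unshuffles w).map fun q => F q.1 * G q.2).sum

/-- Half-shuffle product of two functions on words: the last letter comes from the
second factor. -/
def halfMul {α A : Type*} [CommRing A] (F G : List α → A) (w : List α) : A :=
  match w.getLast? with
  | none => 0
  | some x => shuffleMul F (fun v => G (v ++ [x])) w.dropLast

section Products

variable {α κ A : Type*} [CommRing A]

@[simp]
theorem shuffleMul_nil (F G : List α → A) : shuffleMul F G [] = F [] * G [] := by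
  simp [shuffleMul, unshuffles]

theorem shuffleMul_cons (F G : List α → A) (a : α) (w : List α) :
    shuffleMul F G (a :: w) =
      shuffleMul (fun v => F (a :: v)) G w + shuffleMul F (fun v => G (a :: v)) w := by
  simp [shuffleMul, unshuffles, Multiset.map_map]

@[simp]
theorem halfMul_nil (F G : List α → A) : halfMul F G [] = 0 := rfl

@[simp]
theorem halfMul_concat (F G : List α → A) (w : List α) (x : α) :
    halfMul F G (w ++ [x]) = shuffleMul F (fun v => G (v ++ [x])) w := by
  simp [halfMul]

theorem shuffleMul_append (F G : List α → A) (u w : List α) :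
    shuffleMul F G (u ++ w) = ((unshuffles u).map fun q =>
      shuffleMul (fun v => F (q.1 ++ v)) (fun v => G (q.2 ++ v)) w).sum := by
  induction u generalizing F G with
  | nil => simp [unshuffles]
  | cons a u ih =>
    simp [shuffleMul_cons, unshuffles, ih, Multiset.map_map]

theorem shuffleMul_sum_sum {ι₁ ι₂ : Type*} (S₁ : Finset ι₁) (S₂ : Finset ι₂) (a : ι₁ → A)
    (b : ι₂ → A) (F : ι₁ → List α → A) (G : ι₂ → List α → A) (w : List α) :
    shuffleMul (fun v => ∑ i ∈ S₁, F i v * a i) (fun v => ∑ j ∈ S₂, G j v * b j) w =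
      ∑ i ∈ S₁, ∑ j ∈ S₂, a i * b j * shuffleMul (F i) (G j) w := by
  induction w generalizing F G with
  | nil =>
    simp only [shuffleMul_nil, Finset.sum_mul_sum]
    exact Finset.sum_congr rfl fun i _ => Finset.sum_congr rfl fun j _ => by ring
  | cons c w ih =>
    simp only [shuffleMul_cons]
    rw [ih (fun i v => F i (c :: v)) G, ih F (fun j v => G j (c :: v))]
    simp only [mul_add, Finset.sum_add_distrib]

theorem shuffleMul_sum_left {ι : Type*} (S : Finset ι) (a : ι → A) (F : ι → List α → A)
    (G : List α → A) (w : List α) :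
    shuffleMul (fun v => ∑ i ∈ S, a i * F i v) G w = ∑ i ∈ S, a i * shuffleMul (F i) G w := by
  have := shuffleMul_sum_sum S {()} a (fun _ => 1) F (fun _ => G) w
  simpa [mul_comm] using this

theorem shuffleMul_eq_zero {F : List α → A} (G : List α → A) {w : List α}
    (h : ∀ v : List α, v.length ≤ w.length → F v = 0) : shuffleMul F G w = 0 := by
  induction w generalizing F G with
  | nil => simp [h]
  | cons a w ih =>
    rw [shuffleMul_cons, ih G fun v hv => h _ (by simpa using hv),
      ih _ fun v hv => h _ (by simp; omega), add_zero]

theorem map_shuffleMul {B : Type*} [CommRing B] (φ : A →+* B) (F G : List α → A) (w : List α) :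
    φ (shuffleMul F G w) = shuffleMul (fun v => φ (F v)) (fun v => φ (G v)) w := by
  simp [shuffleMul, map_multiset_sum, Multiset.map_map]

theorem map_halfMul {B : Type*} [CommRing B] (φ : A →+* B) (F G : List α → A) (w : List α) :
    φ (halfMul F G w) = halfMul (fun v => φ (F v)) (fun v => φ (G v)) w := by
  induction w using List.reverseRecOn with
  | nil => simp
  | append_singleton w x => simp [map_shuffleMul]

/-- Iterated half-shuffle product, bracketed to the left, of the functions indexed by a
list; the empty product is the indicator function of the empty word. -/
def halfProd (H : κ → List α → A) (ks : List κ) : List α → A :=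
  ks.foldl (fun F k => halfMul F (H k)) (fun w => if w.isEmpty then 1 else 0)

theorem halfProd_nil (H : κ → List α → A) (w : List α) :
    halfProd H [] w = if w.isEmpty then 1 else 0 := rfl

theorem halfProd_concat (H : κ → List α → A) (ks : List κ) (k : κ) :
    halfProd H (ks ++ [k]) = halfMul (halfProd H ks) (H k) := by
  simp [halfProd]

theorem halfProd_apply_nil (H : κ → List α → A) {ks : List κ} (h : ks ≠ []) :
    halfProd H ks [] = 0 := by
  induction ks using List.reverseRecOn with
  | nil => exact absurd rfl h
  | append_singleton ks k => simp [halfProd_concat]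

theorem halfProd_eq_zero (H : κ → List α → A) {ks : List κ} {w : List α}
    (h : w.length < ks.length) : halfProd H ks w = 0 := by
  induction ks using List.reverseRecOn generalizing w with
  | nil => simp at h
  | append_singleton ks k ih =>
    rw [halfProd_concat]
    induction w using List.reverseRecOn with
    | nil => simp
    | append_singleton w x =>
      rw [halfMul_concat]
      exact shuffleMul_eq_zero _ fun v hv => ih (by simp at h; omega)

theorem map_halfProd {B : Type*} [CommRing B] (φ : A →+* B) (H : κ → List α → A)
    (ks : List κ) (w : List α) :
    φ (halfProd H ks w) = halfProd (fun k v => φ (H k v)) ks w := by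
  induction ks using List.reverseRecOn generalizing w with
  | nil => simp [halfProd_nil, apply_ite φ]
  | append_singleton ks k ih => simp [halfProd_concat, map_halfMul, ih]

theorem halfMul_unit_left (H : List α → A) {w : List α} (hw : w ≠ []) :
    halfMul (fun v => if v.isEmpty then 1 else 0) H w = H w := by
  have key : ∀ (G : List α → A) (v : List α),
      shuffleMul (fun v => if v.isEmpty then 1 else 0) G v = G v := by
    intro G v
    induction v generalizing G with
    | nil => simp
    | cons a v ih =>
      rw [shuffleMul_cons, ih, shuffleMul_eq_zero _ (by simp), zero_add]
  induction w using List.reverseRecOn with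
  | nil => exact absurd rfl hw
  | append_singleton w x => rw [halfMul_concat, key]

end Products

/-- The finite set of words of length less than `n`. -/
def wordsBelow (α : Type*) [Fintype α] (n : ℕ) : Finset (List α) :=
  ((Finset.range n).sigma fun l => (Finset.univ : Finset (Fin l → α))).map
    List.equivSigmaTuple.symm.toEmbedding

section Words

variable {α A : Type*} [Fintype α] [CommRing A]

@[simp]
theorem mem_wordsBelow {n : ℕ} {w : List α} : w ∈ wordsBelow α n ↔ w.length < n := by
  simp [wordsBelow, Finset.mem_map_equiv, List.equivSigmaTuple]

theorem sum_wordsBelow {M : Type*} [AddCommMonoid M] (n : ℕ) (f : List α → M) :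
    ∑ w ∈ wordsBelow α n, f w = ∑ l ∈ Finset.range n, ∑ v : Fin l → α, f (List.ofFn v) := by
  simp [wordsBelow, Finset.sum_sigma, List.equivSigmaTuple]

/-- Pairs of words of total length less than `n`. -/
def wordPairsBelow (α : Type*) [Fintype α] (n : ℕ) : Finset (List α × List α) :=
  (wordsBelow α n ×ˢ wordsBelow α n).filter fun q => q.1.length + q.2.length < n

@[simp]
theorem mem_wordPairsBelow {n : ℕ} {q : List α × List α} :
    q ∈ wordPairsBelow α n ↔ q.1.length + q.2.length < n := by
  simp only [wordPairsBelow, Finset.mem_filter, Finset.mem_product, mem_wordsBelow]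
  omega

theorem sum_wordPairsBelow {M : Type*} [AddCommMonoid M] (n : ℕ) (f : List α → List α → M) :
    ∑ q ∈ wordPairsBelow α n, f q.1 q.2 =
      ∑ v ∈ wordsBelow α n, ∑ u ∈ wordsBelow α (n - v.length), f u v := by
  rw [Finset.sum_sigma']
  refine Finset.sum_nbij' (fun q => ⟨q.2, q.1⟩) (fun q => (q.2, q.1)) ?_ ?_ ?_ ?_ ?_
  · intro q hq
    simp only [mem_wordPairsBelow] at hq
    simp only [Finset.mem_sigma, mem_wordsBelow]
    omega
  · rintro ⟨v, u⟩ hq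
    simp only [Finset.mem_sigma, mem_wordsBelow] at hq
    simp only [mem_wordPairsBelow]
    omega
  all_goals simp

theorem sum_wordsBelow_splits {M : Type*} [AddCommMonoid M] (n : ℕ)
    (f : List α → List α → M) :
    ∑ w ∈ wordsBelow α n, ∑ i ∈ Finset.range (w.length + 1), f (w.take i) (w.drop i) =
      ∑ q ∈ wordPairsBelow α n, f q.1 q.2 := by
  rw [Finset.sum_sigma']
  refine Finset.sum_nbij' (fun q => (q.1.take q.2, q.1.drop q.2))
    (fun q => ⟨q.1 ++ q.2, q.1.length⟩) ?_ ?_ ?_ ?_ ?_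
  · rintro ⟨w, i⟩ hq
    simp only [Finset.mem_sigma, mem_wordsBelow, Finset.mem_range] at hq
    simp only [mem_wordPairsBelow, List.length_take, List.length_drop]
    omega
  · intro q hq
    simp only [mem_wordPairsBelow] at hq
    simp only [Finset.mem_sigma, mem_wordsBelow, Finset.mem_range, List.length_append]
    omega
  · rintro ⟨w, i⟩ hq
    simp only [Finset.mem_sigma, mem_wordsBelow, Finset.mem_range] at hq
    simp only [List.take_append_drop, List.length_take]
    congr
    omega
  all_goals simp

theorem Multiset.sum_map_eq_sum_count_mul {β : Type*} [DecidableEq β] (m : Multiset β)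
    (S : Finset β) (f : β → A) (h : ∀ x ∈ m, x ∉ S → f x = 0) :
    (m.map f).sum = ∑ x ∈ S, (m.count x : A) * f x := by
  rw [Finset.sum_multiset_map_count]
  refine Finset.sum_congr_of_eq_on_inter (fun x hx hxS => ?_) (fun x _ hx => ?_)
    fun x _ _ => nsmul_eq_mul _ _
  · rw [h x (by simpa using hx) hxS, smul_zero]
  · rw [Multiset.count_eq_zero.2 (by simpa using hx), Nat.cast_zero, zero_mul]

theorem sum_wordsBelow_unshuffles (n : ℕ) (X : List α → A) (Φ : List α × List α → A) :
    ∑ w ∈ wordsBelow α n, X w * ((unshuffles w).map Φ).sum =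
      ∑ q ∈ wordPairsBelow α n, ((shuffles q.1 q.2).map X).sum * Φ q := by
  classical
  have h1 : ∀ w ∈ wordsBelow α n, X w * ((unshuffles w).map Φ).sum =
      ∑ q ∈ wordPairsBelow α n, X w * (((unshuffles w).count q : A) * Φ q) := by
    intro w hw
    rw [Multiset.sum_map_eq_sum_count_mul _ (wordPairsBelow α n), Finset.mul_sum]
    intro q hq hqS
    have := length_of_mem_unshuffles hq
    simp only [mem_wordsBelow, mem_wordPairsBelow] at *
    omega
  have h2 : ∀ q ∈ wordPairsBelow α n, ((shuffles q.1 q.2).map X).sum * Φ q =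
      ∑ w ∈ wordsBelow α n, ((unshuffles w).count q : A) * X w * Φ q := by
    intro q hq
    rw [Multiset.sum_map_eq_sum_count_mul _ (wordsBelow α n), Finset.sum_mul]
    · simp [count_shuffles]
    intro w hw hwS
    have := length_of_mem_shuffles hw
    simp only [mem_wordsBelow, mem_wordPairsBelow] at *
    omega
  rw [Finset.sum_congr rfl h1, Finset.sum_congr rfl h2, Finset.sum_comm]
  exact Finset.sum_congr rfl fun q _ => Finset.sum_congr rfl fun w _ => by ring

/-- The truncated Gubinelli expansion of `F` along `X`, with words of length less than `n`. -/
def expansion (n : ℕ) (X F : List α → A) (w : List α) : A :=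
  ∑ u ∈ wordsBelow α n, F (u ++ w) * X u

theorem expansion_shuffleMul (n : ℕ) (X F G : List α → A) (w : List α) :
    expansion n X (shuffleMul F G) w = ∑ q ∈ wordPairsBelow α n,
      ((shuffles q.1 q.2).map X).sum *
        shuffleMul (fun v => F (q.1 ++ v)) (fun v => G (q.2 ++ v)) w := by
  simp only [expansion, shuffleMul_append, mul_comm _ (X _)]
  exact sum_wordsBelow_unshuffles n X
    (fun q => shuffleMul (fun v => F (q.1 ++ v)) (fun v => G (q.2 ++ v)) w)

theorem shuffleMul_expansion (n : ℕ) (X F G : List α → A) (w : List α) :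
    shuffleMul (expansion n X F) (expansion n X G) w =
      ∑ q ∈ wordsBelow α n ×ˢ wordsBelow α n, X q.1 * X q.2 *
        shuffleMul (fun v => F (q.1 ++ v)) (fun v => G (q.2 ++ v)) w := by
  rw [Finset.sum_product]
  exact shuffleMul_sum_sum _ _ X X (fun u v => F (u ++ v)) (fun u v => G (u ++ v)) w

end Words

/-- A decreasing multiplicative filtration, by additive subgroups, of a commutative ring or
of a subring of it. -/
structure RingFiltration (A : Type*) [CommRing A] where
  toFun : ℕ → AddSubgroup A
  anti : Antitone toFun
  one_mem : (1 : A) ∈ toFun 0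
  mul_mem : ∀ {m n : ℕ} {a b : A}, a ∈ toFun m → b ∈ toFun n → a * b ∈ toFun (m + n)

namespace RingFiltration

variable {α κ A : Type*} [CommRing A] (J : RingFiltration A)

theorem mul_mem_left {n : ℕ} {a b : A} (ha : a ∈ J.toFun 0) (hb : b ∈ J.toFun n) :
    a * b ∈ J.toFun n := by
  simpa using J.mul_mem ha hb

theorem mul_mem_right {n : ℕ} {a b : A} (ha : a ∈ J.toFun n) (hb : b ∈ J.toFun 0) :
    a * b ∈ J.toFun n := by
  simpa using J.mul_mem ha hb

theorem mul_sub_mul_mem {n : ℕ} {a a' b b' : A} (ha : a ∈ J.toFun 0) (hb' : b' ∈ J.toFun 0)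
    (haa : a - a' ∈ J.toFun n) (hbb : b - b' ∈ J.toFun n) : a * b - a' * b' ∈ J.toFun n := by
  have : a * b - a' * b' = a * (b - b') + (a - a') * b' := by ring
  rw [this]
  exact add_mem (J.mul_mem_left ha hbb) (J.mul_mem_right haa hb')

theorem shuffleMul_mem {F G : List α → A} (hF : ∀ v, F v ∈ J.toFun 0)
    (hG : ∀ v, G v ∈ J.toFun 0) (w : List α) : shuffleMul F G w ∈ J.toFun 0 := by
  induction w generalizing F G with
  | nil => simpa using J.mul_mem_left (hF []) (hG [])
  | cons a w ih =>
    rw [shuffleMul_cons]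
    exact add_mem (ih (fun _ => hF _) hG) (ih hF fun _ => hG _)

theorem halfMul_mem {F G : List α → A} (hF : ∀ v, F v ∈ J.toFun 0)
    (hG : ∀ v, G v ∈ J.toFun 0) (w : List α) : halfMul F G w ∈ J.toFun 0 := by
  induction w using List.reverseRecOn with
  | nil => simp
  | append_singleton w x =>
    rw [halfMul_concat]
    exact J.shuffleMul_mem hF (fun _ => hG _) w

theorem halfProd_mem {H : κ → List α → A} (hH : ∀ k v, H k v ∈ J.toFun 0) (ks : List κ)
    (w : List α) : halfProd H ks w ∈ J.toFun 0 := by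
  induction ks using List.reverseRecOn generalizing w with
  | nil =>
    rw [halfProd_nil]
    split_ifs
    exacts [J.one_mem, zero_mem _]
  | append_singleton ks k ih =>
    rw [halfProd_concat]
    exact J.halfMul_mem ih (hH k) w

theorem shuffleMul_sub_mem {n : ℕ} {F F' G G' : List α → A} (hF : ∀ v, F v ∈ J.toFun 0)
    (hG' : ∀ v, G' v ∈ J.toFun 0) {w : List α}
    (hFF : ∀ v : List α, v.length ≤ w.length → F v - F' v ∈ J.toFun n)
    (hGG : ∀ v : List α, v.length ≤ w.length → G v - G' v ∈ J.toFun n) :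
    shuffleMul F G w - shuffleMul F' G' w ∈ J.toFun n := by
  induction w generalizing F G F' G' with
  | nil =>
    simpa using J.mul_sub_mul_mem (hF []) (hG' []) (hFF [] le_rfl) (hGG [] le_rfl)
  | cons a w ih =>
    rw [shuffleMul_cons, shuffleMul_cons, add_sub_add_comm]
    refine add_mem (ih (fun _ => hF _) hG' ?_ ?_) (ih hF (fun _ => hG' _) ?_ ?_)
    · exact fun v hv => hFF _ (by simpa using hv)
    · exact fun v hv => hGG _ (by simp; omega)
    · exact fun v hv => hFF _ (by simp; omega)
    · exact fun v hv => hGG _ (by simpa using hv)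

theorem halfProd_sub_mem {n b : ℕ} {H H' : κ → List α → A} (hH : ∀ k v, H k v ∈ J.toFun 0)
    (hH' : ∀ k v, H' k v ∈ J.toFun 0)
    (hHH : ∀ k (v : List α), v.length ≤ b → H k v - H' k v ∈ J.toFun n) (ks : List κ)
    {w : List α} (hw : w.length ≤ b) : halfProd H ks w - halfProd H' ks w ∈ J.toFun n := by
  induction ks using List.reverseRecOn generalizing w with
  | nil => simp [halfProd_nil]
  | append_singleton ks k ih =>
    simp only [halfProd_concat]
    induction w using List.reverseRecOn with
    | nil => simp
    | append_singleton w x =>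
      simp only [List.length_append, List.length_singleton] at hw
      rw [halfMul_concat, halfMul_concat]
      refine J.shuffleMul_sub_mem (J.halfProd_mem hH ks) (fun _ => hH' k _)
        (fun v hv => ih (by omega)) fun v hv => hHH k _ ?_
      simp
      omega

variable [Fintype α]

theorem expansion_mem {X F : List α → A} (hX : ∀ v, X v ∈ J.toFun v.length)
    (hF : ∀ v, F v ∈ J.toFun 0) (n : ℕ) (w : List α) : expansion n X F w ∈ J.toFun 0 :=
  sum_mem fun _ _ => J.mul_mem_left (hF _) (J.anti (Nat.zero_le _) (hX _))

theorem sum_wordsBelow_sub_mem {m n : ℕ} (h : m ≤ n) {X F : List α → A}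
    (hX : ∀ v, X v ∈ J.toFun v.length) (hF : ∀ v, F v ∈ J.toFun 0) :
    ∑ u ∈ wordsBelow α n, F u * X u - ∑ u ∈ wordsBelow α m, F u * X u ∈ J.toFun m := by
  classical
  have hsub : wordsBelow α m ⊆ wordsBelow α n := fun u hu => by
    simp only [mem_wordsBelow] at *
    omega
  rw [← Finset.sum_sdiff hsub, add_sub_cancel_right]
  refine sum_mem fun u hu => J.mul_mem_left (hF u) (J.anti ?_ (hX u))
  simpa using (Finset.mem_sdiff.1 hu).2

/-- Expanding along a truncated character of the shuffle algebra is multiplicative up to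
the truncation order. -/
theorem expansion_shuffleMul_sub_mem {n : ℕ} {X F G : List α → A}
    (hX : ∀ v, X v ∈ J.toFun v.length)
    (hmul : ∀ u v : List α, u.length + v.length < n → X u * X v = ((shuffles u v).map X).sum)
    (hF : ∀ v, F v ∈ J.toFun 0) (hG : ∀ v, G v ∈ J.toFun 0) (w : List α) :
    expansion n X (shuffleMul F G) w - shuffleMul (expansion n X F) (expansion n X G) w ∈
      J.toFun n := by
  classical
  have hsub : wordPairsBelow α n ⊆ wordsBelow α n ×ˢ wordsBelow α n := Finset.filter_subset _ _
  rw [expansion_shuffleMul, shuffleMul_expansion, ← Finset.sum_sdiff hsub, ← sub_sub,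
    sub_right_comm, Finset.sum_congr rfl fun q hq => by
      rw [← hmul q.1 q.2 (mem_wordPairsBelow.1 hq)], sub_self, zero_sub]
  refine neg_mem (sum_mem fun q hq => J.mul_mem_right (J.anti ?_ (J.mul_mem (hX _) (hX _)))
    (J.shuffleMul_mem (fun _ => hF _) (fun _ => hG _) w))
  simpa using (Finset.mem_sdiff.1 hq).2

/-- The expansion of an iterated half-shuffle product, up to the truncation order. -/
theorem expansion_halfProd_sub_mem {n : ℕ} {X : List α → A} {H : κ → List α → A}
    (hX : ∀ v, X v ∈ J.toFun v.length) (hX0 : X [] = 1) (hn : 0 < n)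
    (hmul : ∀ u v : List α, u.length + v.length < n → X u * X v = ((shuffles u v).map X).sum)
    (hH : ∀ k v, H k v ∈ J.toFun 0) (ks : List κ) (w : List α) :
    expansion n X (halfProd H ks) w - ∑ i ∈ Finset.range (ks.length + 1),
      expansion n X (halfProd H (ks.take i)) [] *
        halfProd (fun k => expansion n X (H k)) (ks.drop i) w ∈ J.toFun n := by
  have hEmem : ∀ ls v, expansion n X (halfProd H ls) v ∈ J.toFun 0 := fun ls =>
    J.expansion_mem hX (J.halfProd_mem hH ls) n
  have hPmem : ∀ ls v, halfProd (fun k => expansion n X (H k)) ls v ∈ J.toFun 0 :=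
    J.halfProd_mem fun k => J.expansion_mem hX (hH k) n
  induction ks using List.reverseRecOn generalizing w with
  | nil =>
    have h0 : ∀ v : List α, expansion n X (halfProd H []) v = if v.isEmpty then 1 else 0 := by
      intro v
      rw [expansion, Finset.sum_eq_single []]
      · simp [halfProd_nil, hX0]
      · simp +contextual [halfProd_nil]
      · simp [hn]
    simp [h0, halfProd_nil]
  | append_singleton ks k ih =>
    rw [Finset.sum_range_succ, List.length_append, List.length_singleton]
    induction w using List.reverseRecOn with
    | nil =>
      rw [Finset.sum_eq_zero]
      · simp [halfProd_nil, List.take_of_length_le, List.drop_of_length_le]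
      · intro i hi
        rw [halfProd_apply_nil, mul_zero]
        simp only [Finset.mem_range] at hi
        simpa using by omega
    | append_singleton w x =>
      have hlast : (ks ++ [k]).drop (ks.length + 1) = [] := by simp
      have hsum : ∑ i ∈ Finset.range (ks.length + 1),
          expansion n X (halfProd H ((ks ++ [k]).take i)) [] *
            halfProd (fun k => expansion n X (H k)) ((ks ++ [k]).drop i) (w ++ [x]) =
          shuffleMul (fun v => ∑ i ∈ Finset.range (ks.length + 1),
            expansion n X (halfProd H (ks.take i)) [] *
              halfProd (fun k => expansion n X (H k)) (ks.drop i) v)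
            (fun v => expansion n X (H k) (v ++ [x])) w := by
        rw [shuffleMul_sum_left]
        refine Finset.sum_congr rfl fun i hi => ?_
        have hi' : i ≤ ks.length := by simpa [Nat.lt_succ_iff] using hi
        rw [List.take_append_of_le_length hi', List.drop_append_of_le_length hi',
          halfProd_concat, halfMul_concat]
      have hE : expansion n X (halfProd H (ks ++ [k])) (w ++ [x]) =
          expansion n X (shuffleMul (halfProd H ks) fun v => H k (v ++ [x])) w := by
        simp only [expansion, halfProd_concat, ← List.append_assoc, halfMul_concat]
      have hEk : (fun v => expansion n X (H k) (v ++ [x])) =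
          expansion n X fun v => H k (v ++ [x]) := by
        funext v
        simp [expansion]
      rw [hlast, hsum, hE, halfProd_nil, hEk]
      simp only [List.isEmpty_iff, List.append_eq_nil_iff, List.cons_ne_self, and_false,
        if_false, mul_zero, add_zero]
      have h1 := J.expansion_shuffleMul_sub_mem hX hmul (J.halfProd_mem hH ks)
        (G := fun v => H k (v ++ [x])) (fun v => hH k _) w
      have h2 := J.shuffleMul_sub_mem (n := n) (w := w) (hEmem ks)
        (J.expansion_mem hX (F := fun v => H k (v ++ [x])) (fun v => hH k _) n)
        (fun v _ => ih v) (fun v _ => by rw [sub_self]; exact zero_mem _)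
      simpa using add_mem h1 h2

end RingFiltration

section OrderedShuffles

theorem count_osh2 {α : Type*} [DecidableEq α] (u v w : List α) (x : α) :
    (osh2 u v).count (w ++ [x]) =
      ((unshuffles w).map fun q => (q.1, q.2 ++ [x])).count (u, v) := by
  induction v using List.reverseRecOn with
  | nil => simp [osh2]
  | append_singleton v y =>
    simp only [osh2, List.getLast?_concat, List.dropLast_concat]
    by_cases hxy : x = y
    · subst hxy
      rw [Multiset.count_map_eq_count' (· ++ [x]) _ (List.append_left_injective [x]) w,
        Multiset.count_map_eq_count' (fun q : List α × List α => (q.1, q.2 ++ [x])) _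
          (fun x y h => by simpa [Prod.ext_iff] using h) (u, v), count_shuffles]
    · rw [Multiset.count_eq_zero.2 (by simp [Ne.symm hxy]),
        Multiset.count_eq_zero.2 (by simp [hxy])]

theorem length_of_mem_osh2 {α : Type*} {u v w : List α} (h : w ∈ osh2 u v) :
    w.length = u.length + v.length ∧ v ≠ [] := by
  induction v using List.reverseRecOn with
  | nil => simp [osh2] at h
  | append_singleton v y =>
    simp only [osh2, List.getLast?_concat, List.dropLast_concat, Multiset.mem_map] at h
    obtain ⟨z, hz, rfl⟩ := h
    have := length_of_mem_shuffles hz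
    simp
    omega

theorem oshMany_concat {α : Type*} (ws : List (List α)) (w : List α) :
    oshMany (ws ++ [w]) = (oshMany ws).bind fun u => osh2 u w := by
  simp [oshMany]

theorem length_of_mem_oshMany {α : Type*} {ws : List (List α)} {w : List α}
    (h : w ∈ oshMany ws) : w.length = (ws.map List.length).sum ∧ ∀ v ∈ ws, v ≠ [] := by
  induction ws using List.reverseRecOn generalizing w with
  | nil => simp_all [oshMany]
  | append_singleton ws v ih =>
    rw [oshMany_concat, Multiset.mem_bind] at h
    obtain ⟨u, hu, hw⟩ := h
    obtain ⟨h1, h2⟩ := ih hu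
    obtain ⟨h3, h4⟩ := length_of_mem_osh2 hw
    constructor
    · simp [h3, h1]
    · intro v' hv'
      simp only [List.mem_append, List.mem_singleton] at hv'
      rcases hv' with hv' | rfl
      exacts [h2 v' hv', h4]

variable {α A : Type*} [Fintype α] [DecidableEq α] [CommRing A]

theorem sum_count_osh2 {n : ℕ} (F G : List α → A) {w : List α} (hw : w.length < n) :
    ∑ v ∈ wordsBelow α n, ∑ u ∈ wordsBelow α n, ((osh2 u v).count w : A) * (F u * G v) =
      halfMul F G w := by
  rw [Finset.sum_comm]
  induction w using List.reverseRecOn with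
  | nil =>
    refine Finset.sum_eq_zero fun u _ => Finset.sum_eq_zero fun v _ => ?_
    rw [Multiset.count_eq_zero.2, Nat.cast_zero, zero_mul]
    intro h
    obtain ⟨h1, h2⟩ := length_of_mem_osh2 h
    have := List.length_pos_iff.2 h2
    simp at h1
    omega
  | append_singleton w x =>
    have h1 : halfMul F G (w ++ [x]) =
        (((unshuffles w).map fun q => (q.1, q.2 ++ [x])).map fun q => F q.1 * G q.2).sum := by
      simp [shuffleMul, Multiset.map_map]
    rw [h1, Multiset.sum_map_eq_sum_count_mul _ (wordsBelow α n ×ˢ wordsBelow α n),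
      Finset.sum_product]
    · simp only [count_osh2]
    · intro q hq hqS
      obtain ⟨r, hr, rfl⟩ := Multiset.mem_map.1 hq
      have := length_of_mem_unshuffles hr
      simp at hw hqS
      omega

theorem sum_bWord {d N : ℕ} {M : Type*} [AddCommMonoid M] (f : List (Fin d) → M) :
    ∑ g : BWord d N, f (bwList g) = ∑ w ∈ wordsBelow (Fin d) (N + 1), f w := by
  rw [sum_wordsBelow, Finset.sum_range, Fintype.sum_sigma]
  rfl

/-- The left-bracketed half-shuffle product is dual to the ordered shuffles of words. -/
theorem sum_count_oshMany {κ : Type*} {d N m : ℕ} (H : κ → List (Fin d) → A) (ks : Fin m → κ)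
    {w : List (Fin d)} (hw : w.length ≤ N) :
    ∑ g : Fin m → BWord d N, ((oshMany (List.ofFn fun i => bwList (g i))).count w : A) *
      ∏ i, H (ks i) (bwList (g i)) = halfProd H (List.ofFn ks) w := by
  induction m generalizing w with
  | zero =>
    simp [oshMany, halfProd_nil, Multiset.count_singleton]
  | succ m ih =>
    rw [List.ofFn_succ', List.concat_eq_append, halfProd_concat,
      ← sum_count_osh2 _ _ (Nat.lt_succ_of_le hw),
      ← sum_bWord fun v => ∑ u ∈ wordsBelow (Fin d) (N + 1), ((osh2 u v).count w : A) *
        (halfProd H (List.ofFn fun i : Fin m => ks i.castSucc) u * H (ks (Fin.last m)) v),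
      ← (Fin.snocEquiv fun _ : Fin (m + 1) => BWord d N).sum_comp, Fintype.sum_prod_type]
    refine Finset.sum_congr rfl fun v _ => ?_
    have hcount : ∀ g : Fin m → BWord d N,
        (((oshMany (List.ofFn fun i => bwList (g i))).bind fun u =>
          osh2 u (bwList v)).count w : A) = ∑ u ∈ wordsBelow (Fin d) (N + 1),
            ((oshMany (List.ofFn fun i => bwList (g i))).count u : A) *
              ((osh2 u (bwList v)).count w : A) := by
      intro g
      rw [Multiset.count_bind, ← Multiset.sum_map_eq_sum_count_mul, Nat.cast_multiset_sum,
        Multiset.map_map]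
      · rfl
      · intro u _ hu
        rw [Multiset.count_eq_zero.2, Nat.cast_zero]
        intro h
        have := (length_of_mem_osh2 h).1
        simp at hu
        omega
    simp only [Fin.snocEquiv_apply, List.ofFn_succ', List.concat_eq_append, oshMany_concat,
      Fin.snoc_castSucc, Fin.snoc_last, hcount, Fin.prod_univ_castSucc, Finset.sum_mul]
    rw [Finset.sum_comm]
    refine Finset.sum_congr rfl fun u hu => ?_
    rw [← ih (fun i => ks i.castSucc) (by simpa [Nat.lt_succ_iff] using hu), Finset.sum_mul,
      Finset.mul_sum]
    exact Finset.sum_congr rfl fun g _ => by ring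

end OrderedShuffles

theorem starComp_eq {d e f N : ℕ} (K : ℝ → List (Fin e) → Fin f → ℝ)
    (H : ℝ → List (Fin d) → Fin e → ℝ) (s : ℝ) {w : List (Fin d)} (hw : w.length ≤ N)
    (c : Fin f) {n : ℕ} (hn : w.length < n) :
    starComp d e f N K H s w c =
      ∑ ks ∈ wordsBelow (Fin e) n, K s ks c * halfProd (fun k v => H s v k) ks w := by
  rw [starComp, if_neg (by omega)]
  split_ifs with h0
  · subst h0
    rw [Finset.sum_eq_single []]
    · simp [halfProd_nil]
    · intro ks _ hks
      rw [halfProd_apply_nil _ hks, mul_zero]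
    · simp at hn ⊢
      omega
  · rw [sum_wordsBelow]
    refine Eq.trans ?_ (Finset.sum_subset (s₁ := Finset.Icc 1 w.length) ?_ ?_)
    · refine Finset.sum_congr rfl fun m _ => ?_
      simp only [← sum_count_oshMany _ _ hw, Finset.mul_sum]
      rw [Finset.sum_comm]
      exact Finset.sum_congr rfl fun g _ => Finset.sum_congr rfl fun ks _ => by ring
    · intro m hm
      simp at hm ⊢
      omega
    · intro m _ hm
      refine Finset.sum_eq_zero fun ks _ => ?_
      rcases Nat.eq_zero_or_pos m with rfl | hm0
      · simp [halfProd_nil, h0]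
      · rw [halfProd_eq_zero, mul_zero]
        simp at hm ⊢
        omega

theorem length_of_mem_oshMany_bWord {d N m : ℕ} (g : Fin m → BWord d N) {w : List (Fin d)}
    (hw : w ∈ oshMany (List.ofFn fun i => bwList (g i))) :
    w.length = ∑ i, ((g i).1 : ℕ) ∧ ∀ i, 1 ≤ ((g i).1 : ℕ) := by
  obtain ⟨h1, h2⟩ := length_of_mem_oshMany hw
  refine ⟨by simpa [List.map_ofFn, List.sum_ofFn, bwList] using h1, fun i => ?_⟩
  have := List.length_pos_iff.2 (h2 _ (List.mem_ofFn.2 ⟨i, rfl⟩))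
  rwa [bwList, List.length_ofFn] at this

theorem liftApprox_eq {d N : ℕ} {ι : Type*} (X : ℝ → ℝ → List (Fin d) → ℝ)
    (H : ℝ → List (Fin d) → ι → ℝ) (s t : ℝ) {ks : List ι} (hks : 2 ≤ ks.length) :
    liftApprox d N X H s t ks = ∑ w ∈ wordsBelow (Fin d) (N + 1),
      halfProd (fun k v => H s v k) ks w * X s t w := by
  obtain _ | ⟨k₁, _ | ⟨k₂, ks⟩⟩ := ks
  · simp at hks
  · simp at hks
  have hterm : ∀ g : Fin (k₁ :: k₂ :: ks).length → BWord d N,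
      (if (∀ i, 1 ≤ ((g i).1 : ℕ)) ∧ (∑ i, ((g i).1 : ℕ)) ≤ N then
        (∏ i, H s (bwList (g i)) ((k₁ :: k₂ :: ks).get i)) *
          ((oshMany (List.ofFn fun i => bwList (g i))).map (X s t)).sum else 0) =
      ∑ w ∈ wordsBelow (Fin d) (N + 1),
        ((oshMany (List.ofFn fun i => bwList (g i))).count w : ℝ) *
          (∏ i, H s (bwList (g i)) ((k₁ :: k₂ :: ks).get i)) * X s t w := by
    intro g
    have hlen := fun w => length_of_mem_oshMany_bWord (w := w) g
    split_ifs with h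
    · rw [Multiset.sum_map_eq_sum_count_mul _ (wordsBelow (Fin d) (N + 1)), Finset.mul_sum]
      · exact Finset.sum_congr rfl fun w _ => by ring
      · intro w hw hwS
        have := (hlen w hw).1
        simp only [mem_wordsBelow] at hwS
        omega
    · refine (Finset.sum_eq_zero fun w hw => ?_).symm
      rw [Multiset.count_eq_zero.2, Nat.cast_zero, zero_mul, zero_mul]
      intro hw'
      obtain ⟨h1, h2⟩ := hlen w hw'
      simp only [mem_wordsBelow] at hw
      exact h ⟨h2, by omega⟩
  rw [liftApprox, Finset.sum_congr rfl fun g _ => hterm g, Finset.sum_comm]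
  refine Finset.sum_congr rfl fun w hw => ?_
  rw [← Finset.sum_mul, sum_count_oshMany (fun k v => H s v k) (k₁ :: k₂ :: ks).get
    (by simpa [Nat.lt_succ_iff] using hw), List.ofFn_get]

/-- The pairs of ordered times in `[0,T]`. -/
abbrev Simplex (T : ℝ) := {q : ℝ × ℝ // 0 ≤ q.1 ∧ q.1 ≤ q.2 ∧ q.2 ≤ T}

/-- The filtration of the functions on the simplex by the order `ω ^ (n / p)`. -/
def controlFiltration {p T : ℝ} (hp : 0 < p) {ω : ℝ → ℝ → ℝ} (hω : IsControl ω T) :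
    RingFiltration (Simplex T → ℝ) where
  toFun n :=
    { carrier := {f | ∃ C, ∀ q, |f q| ≤ C * ω q.1.1 q.1.2 ^ ((n : ℝ) / p)}
      zero_mem' := ⟨0, by simp⟩
      add_mem' := by
        rintro f g ⟨C, hC⟩ ⟨D, hD⟩
        refine ⟨C + D, fun q => (abs_add_le _ _).trans ?_⟩
        rw [add_mul]
        exact add_le_add (hC q) (hD q)
      neg_mem' := by
        rintro f ⟨C, hC⟩
        exact ⟨C, fun q => by simpa using hC q⟩ }
  anti := by
    rintro m n hmn f ⟨C, hC⟩
    refine ⟨|C| * ω 0 T ^ (((n : ℝ) - m) / p), fun q => ?_⟩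
    obtain ⟨-, -, h0, hadd⟩ := hω
    obtain ⟨⟨s, t⟩, hs, hst, ht⟩ := q
    simp only at hs hst ht
    have hle : ω s t ≤ ω 0 T := by
      have h1 := hadd 0 s T le_rfl hs (hst.trans ht) le_rfl
      have h2 := hadd s t T hs hst ht le_rfl
      linarith [h0 0 s, h0 t T]
    have hnm : 0 ≤ ((n : ℝ) - m) / p :=
      div_nonneg (sub_nonneg.2 (Nat.cast_le.2 hmn)) hp.le
    have hsplit : ω s t ^ ((n : ℝ) / p) =
        ω s t ^ (((n : ℝ) - m) / p) * ω s t ^ ((m : ℝ) / p) := by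
      rw [← Real.rpow_add_of_nonneg (h0 s t) hnm (by positivity)]
      congr 1
      ring
    calc |f ⟨(s, t), _⟩| ≤ C * ω s t ^ ((n : ℝ) / p) := hC ⟨(s, t), hs, hst, ht⟩
      _ ≤ |C| * ω s t ^ ((n : ℝ) / p) :=
        mul_le_mul_of_nonneg_right (le_abs_self C) (Real.rpow_nonneg (h0 s t) _)
      _ ≤ |C| * ω 0 T ^ (((n : ℝ) - m) / p) * ω s t ^ ((m : ℝ) / p) := by
        rw [hsplit, mul_assoc]
        have := Real.rpow_nonneg (h0 s t) ((m : ℝ) / p)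
        gcongr
        exact h0 s t
  one_mem := ⟨1, by simp⟩
  mul_mem := by
    rintro m n f g ⟨C, hC⟩ ⟨D, hD⟩
    refine ⟨C * D, fun q => ?_⟩
    have h0 := hω.2.2.1 q.1.1 q.1.2
    rw [Nat.cast_add, add_div, Real.rpow_add_of_nonneg h0 (by positivity) (by positivity),
      Pi.mul_apply, abs_mul, mul_mul_mul_comm]
    exact mul_le_mul (hC q) (hD q) (abs_nonneg _) ((abs_nonneg _).trans (hC q))

section Control

variable {p T : ℝ} (hp : 0 < p) {ω : ℝ → ℝ → ℝ} (hω : IsControl ω T)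

/-- Finitely many memberships in the filtration hold with a common constant. -/
theorem exists_uniform_bound {ι : Type*} (S : Finset ι) (n : ι → ℕ) (f : ι → Simplex T → ℝ)
    (hf : ∀ i ∈ S, f i ∈ (controlFiltration hp hω).toFun (n i)) :
    ∃ C, ∀ i ∈ S, ∀ q, |f i q| ≤ C * ω q.1.1 q.1.2 ^ ((n i : ℝ) / p) := by
  choose! C hC using hf
  refine ⟨∑ i ∈ S, |C i|, fun i hi q => (hC i hi q).trans ?_⟩
  refine mul_le_mul_of_nonneg_right ((le_abs_self _).trans ?_)
    (Real.rpow_nonneg (hω.2.2.1 _ _) _)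
  exact Finset.single_le_sum (f := fun i => |C i|) (fun i _ => abs_nonneg _) hi

/-- A path of families of coefficients, at the initial time. -/
def startVal {α ι : Type*} (T : ℝ) (H : ℝ → List α → ι → ℝ) (k : ι) (w : List α) :
    Simplex T → ℝ := fun q => H q.1.1 w k

/-- A path of families of coefficients, at the final time. -/
def endVal {α ι : Type*} (T : ℝ) (H : ℝ → List α → ι → ℝ) (k : ι) (w : List α) :
    Simplex T → ℝ := fun q => H q.1.2 w k

/-- A two-parameter family of coefficients, as a function on the simplex. -/
def incrVal {α : Type*} (T : ℝ) (X : ℝ → ℝ → List α → ℝ) (w : List α) : Simplex T → ℝ :=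
  fun q => X q.1.1 q.1.2 w

theorem exists_bound_of_continuous {f : ℝ → ℝ} (hf : Continuous f) (T : ℝ) :
    ∃ C, ∀ t, 0 ≤ t → t ≤ T → |f t| ≤ C := by
  obtain ⟨C, hC⟩ := isCompact_Icc.exists_bound_of_continuousOn (s := Set.Icc 0 T) hf.continuousOn
  exact ⟨C, fun t h0 hT => hC t ⟨h0, hT⟩⟩

theorem incrVal_mem {d : ℕ} (R : RoughPath d p T ω) (w : List (Fin d)) :
    incrVal T R.X w ∈ (controlFiltration hp hω).toFun w.length := by
  by_cases hw : w.length ≤ ⌊p⌋₊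
  · obtain ⟨C, hC⟩ := R.regularity
    exact ⟨C, fun q => hC w hw _ _ q.2.1 q.2.2.1 q.2.2.2⟩
  · have h0 : incrVal T R.X w = 0 := funext fun q => R.zero_of_high _ _ w (not_le.1 hw)
    rw [h0]
    exact zero_mem _

theorem incrVal_mul {d : ℕ} (R : RoughPath d p T ω) (u v : List (Fin d))
    (h : u.length + v.length ≤ ⌊p⌋₊) :
    incrVal T R.X u * incrVal T R.X v = ((shuffles u v).map (incrVal T R.X)).sum := by
  funext q
  have := map_multiset_sum (Pi.evalRingHom (fun _ : Simplex T => ℝ) q)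
    ((shuffles u v).map (incrVal T R.X))
  rw [Multiset.map_map] at this
  exact (R.shuffle_rel _ _ q.2.1 q.2.2.1 q.2.2.2 u v h).trans this.symm

variable {d : ℕ} {ι : Type*} {X : ℝ → ℝ → List (Fin d) → ℝ} {H : ℝ → List (Fin d) → ι → ℝ}

theorem IsControlledPath.startVal_mem (hH : IsControlledPath d p T ω X H) (k : ι)
    (w : List (Fin d)) : startVal T H k w ∈ (controlFiltration hp hω).toFun 0 := by
  obtain ⟨C, hC⟩ := exists_bound_of_continuous (hH.2.1 w k) T
  exact ⟨C, fun q => by simpa [startVal] using hC _ q.2.1 (q.2.2.1.trans q.2.2.2)⟩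

theorem IsControlledPath.endVal_mem (hH : IsControlledPath d p T ω X H) (k : ι)
    (w : List (Fin d)) : endVal T H k w ∈ (controlFiltration hp hω).toFun 0 := by
  obtain ⟨C, hC⟩ := exists_bound_of_continuous (hH.2.1 w k) T
  exact ⟨C, fun q => by simpa [endVal] using hC _ (q.2.1.trans q.2.2.1) q.2.2.2⟩

theorem IsControlledPath.endVal_sub_startVal_mem (hH : IsControlledPath d p T ω X H) (k : ι)
    (w : List (Fin d)) :
    endVal T H k w - startVal T H k w ∈ (controlFiltration hp hω).toFun 1 := by
  by_cases hw : w.length ≤ ⌊p⌋₊ - 1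
  · obtain ⟨C, hC⟩ := hH.2.2.1
    exact ⟨C, fun q => by simpa [endVal, startVal] using hC w hw _ _ q.2.1 q.2.2.1 q.2.2.2 k⟩
  · have h0 : endVal T H k w - startVal T H k w = 0 := funext fun q => by
      simp [endVal, startVal, hH.1 _ w k (not_le.1 hw)]
    rw [h0]
    exact zero_mem _

theorem expansion_startVal_apply (n : ℕ) (k : ι) (w : List (Fin d)) (q : Simplex T) :
    expansion n (incrVal T X) (startVal T H k) w q =
      ∑ l ∈ Finset.range n, ∑ α : Fin l → Fin d,
        H q.1.1 (List.ofFn α ++ w) k * X q.1.1 q.1.2 (List.ofFn α) := by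
  simp [expansion, sum_wordsBelow, incrVal, startVal]

theorem IsControlledPath.endVal_sub_expansion_mem (hp1 : 1 ≤ p)
    (hH : IsControlledPath d p T ω X H) (k : ι) {w : List (Fin d)}
    (hw : w.length ≤ ⌊p⌋₊ - 2) :
    endVal T H k w - expansion (⌊p⌋₊ - w.length) (incrVal T X) (startVal T H k) w ∈
      (controlFiltration hp hω).toFun (⌊p⌋₊ - w.length) := by
  obtain ⟨C, hC⟩ := hH.2.2.2
  have h1 : 1 ≤ ⌊p⌋₊ := Nat.le_floor (by simpa using hp1)
  refine ⟨C, fun q => ?_⟩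
  have := hC w.length w.get hw _ _ q.2.1 q.2.2.1 q.2.2.2 k
  rw [List.ofFn_get] at this
  rwa [Pi.sub_apply, expansion_startVal_apply, Nat.cast_sub (by omega)]

theorem IsControlledPath.of_mem [Fintype ι] (hp1 : 1 ≤ p)
    (h0 : ∀ t (w : List (Fin d)) k, ⌊p⌋₊ - 1 < w.length → H t w k = 0)
    (hcont : ∀ w k, Continuous fun t => H t w k)
    (hreg : ∀ k (w : List (Fin d)), w.length ≤ ⌊p⌋₊ - 1 →
      endVal T H k w - startVal T H k w ∈ (controlFiltration hp hω).toFun 1)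
    (hexp : ∀ k (w : List (Fin d)), w.length ≤ ⌊p⌋₊ - 2 →
      endVal T H k w - expansion (⌊p⌋₊ - w.length) (incrVal T X) (startVal T H k) w ∈
        (controlFiltration hp hω).toFun (⌊p⌋₊ - w.length)) :
    IsControlledPath d p T ω X H := by
  have h1 : 1 ≤ ⌊p⌋₊ := Nat.le_floor (by simpa using hp1)
  refine ⟨h0, hcont, ?_, ?_⟩
  · obtain ⟨C, hC⟩ := exists_uniform_bound hp hω
      (wordsBelow (Fin d) (⌊p⌋₊ - 1 + 1) ×ˢ Finset.univ) (fun _ => 1)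
      (fun i : List (Fin d) × ι => endVal T H i.2 i.1 - startVal T H i.2 i.1) fun i hi =>
        hreg i.2 i.1 (by simpa [Nat.lt_succ_iff] using hi)
    refine ⟨C, fun w hw s t hs hst ht k => ?_⟩
    simpa [endVal, startVal] using
      hC (w, k) (by simpa [Nat.lt_succ_iff] using hw) ⟨(s, t), hs, hst, ht⟩
  · obtain ⟨C, hC⟩ := exists_uniform_bound hp hω
      (wordsBelow (Fin d) (⌊p⌋₊ - 2 + 1) ×ˢ Finset.univ) (fun i => ⌊p⌋₊ - i.1.length)
      (fun i : List (Fin d) × ι => endVal T H i.2 i.1 -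
        expansion (⌊p⌋₊ - i.1.length) (incrVal T X) (startVal T H i.2) i.1) fun i hi =>
        hexp i.2 i.1 (by simpa [Nat.lt_succ_iff] using hi)
    refine ⟨C, fun b β hb s t hs hst ht k => ?_⟩
    have := hC (List.ofFn β, k) (by simpa [Nat.lt_succ_iff] using hb) ⟨(s, t), hs, hst, ht⟩
    simp only [List.length_ofFn, Pi.sub_apply, expansion_startVal_apply] at this
    rwa [Nat.cast_sub (by omega)] at this

theorem IsControlledPath.endVal_sub_expansion_mem_of_le {R : RoughPath d p T ω} (hp1 : 1 ≤ p)
    (hH : IsControlledPath d p T ω R.X H) (k : ι) {w : List (Fin d)}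
    (hw : w.length ≤ ⌊p⌋₊ - 2) {r : ℕ} (hr : r ≤ ⌊p⌋₊ - w.length) :
    endVal T H k w - expansion r (incrVal T R.X) (startVal T H k) w ∈
      (controlFiltration hp hω).toFun r := by
  have h1 := (controlFiltration hp hω).anti hr (hH.endVal_sub_expansion_mem hp hω hp1 k hw)
  have h2 := (controlFiltration hp hω).sum_wordsBelow_sub_mem hr (incrVal_mem hp hω R)
    (F := fun u => startVal T H k (u ++ w)) fun v => hH.startVal_mem hp hω k _
  simpa [expansion] using add_mem h1 h2

/-- The lift of a controlled path agrees with the pairing of the rough path with iterated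
half-shuffle products. -/
theorem expansion_halfProd_sub_lift_mem {e : ℕ} {H : ℝ → List (Fin d) → Fin e → ℝ}
    {R : RoughPath d p T ω} (hp1 : 1 ≤ p)
    (hH : IsControlledPath d p T ω R.X H) {Y : ℝ → ℝ → List (Fin e) → ℝ}
    (hY : ∃ C, ∀ w : List (Fin e), w.length ≤ ⌊p⌋₊ → ∀ s t, 0 ≤ s → s ≤ t → t ≤ T →
      |Y s t w - liftApprox d ⌊p⌋₊ R.X H s t w| ≤ C * ω s t ^ (((⌊p⌋₊ : ℝ) + 1) / p))
    {ks : List (Fin e)} (hks : ks.length ≤ ⌊p⌋₊) {r : ℕ} (hr0 : 0 < r) (hr : r ≤ ⌊p⌋₊) :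
    expansion r (incrVal T R.X) (halfProd (startVal T H) ks) [] - incrVal T Y ks ∈
      (controlFiltration hp hω).toFun r := by
  have h1 : incrVal T Y ks - incrVal T (liftApprox d ⌊p⌋₊ R.X H) ks ∈
      (controlFiltration hp hω).toFun (⌊p⌋₊ + 1) := by
    obtain ⟨C, hC⟩ := hY
    refine ⟨C, fun q => ?_⟩
    push_cast
    exact hC ks hks _ _ q.2.1 q.2.2.1 q.2.2.2
  have hmem := fun k => hH.startVal_mem hp hω k
  suffices h2 : expansion r (incrVal T R.X) (halfProd (startVal T H) ks) [] -
      incrVal T (liftApprox d ⌊p⌋₊ R.X H) ks ∈ (controlFiltration hp hω).toFun r by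
    simpa using sub_mem h2 ((controlFiltration hp hω).anti (by omega : r ≤ ⌊p⌋₊ + 1) h1)
  have hnil : [] ∈ wordsBelow (Fin d) r := by simpa using hr0
  by_cases h2 : 2 ≤ ks.length
  · have hlift : incrVal T (liftApprox d ⌊p⌋₊ R.X H) ks = ∑ u ∈ wordsBelow (Fin d) (⌊p⌋₊ + 1),
        halfProd (startVal T H) ks u * incrVal T R.X u := by
      funext q
      simp only [incrVal, liftApprox_eq _ _ _ _ h2, Finset.sum_apply, Pi.mul_apply]
      exact Finset.sum_congr rfl fun u _ => by
        rw [← Pi.evalRingHom_apply (fun _ : Simplex T => ℝ) q (halfProd _ ks u), map_halfProd]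
        rfl
    have := neg_mem ((controlFiltration hp hω).sum_wordsBelow_sub_mem
      (by omega : r ≤ ⌊p⌋₊ + 1) (incrVal_mem hp hω R)
      ((controlFiltration hp hω).halfProd_mem hmem ks))
    rw [hlift]
    simpa [expansion] using this
  · obtain _ | ⟨k, _ | ⟨k₂, ks⟩⟩ := ks
    · have : expansion r (incrVal T R.X) (halfProd (startVal T H) []) [] -
          incrVal T (liftApprox d ⌊p⌋₊ R.X H) [] = 0 := by
        rw [expansion, Finset.sum_eq_single_of_mem [] hnil]
        · funext q
          simp [halfProd_nil, incrVal, R.empty_eq, liftApprox]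
        · simp +contextual [halfProd_nil]
      rw [this]
      exact zero_mem _
    · have hsum : ∑ u ∈ wordsBelow (Fin d) r, startVal T H k u * incrVal T R.X u =
          startVal T H k [] +
            ∑ u ∈ wordsBelow (Fin d) r, halfProd (startVal T H) [k] u * incrVal T R.X u := by
        rw [← Finset.add_sum_erase _ _ hnil, ← Finset.add_sum_erase _
          (fun u => halfProd (startVal T H) [k] u * incrVal T R.X u) hnil,
          halfProd_apply_nil _ (by simp), zero_mul, zero_add]
        congr 1
        · funext q
          simp [incrVal, R.empty_eq]
        · refine Finset.sum_congr rfl fun u hu => ?_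
          have hP : halfProd (startVal T H) [k] = halfMul _ (startVal T H k) :=
            halfProd_concat (startVal T H) [] k
          rw [hP]
          exact congrArg (· * _) (halfMul_unit_left _ (Finset.ne_of_mem_erase hu)).symm
      have h3 := neg_mem (hH.endVal_sub_expansion_mem_of_le hp hω hp1 k (w := []) (by simp)
        (by simpa using hr))
      have h4 : incrVal T (liftApprox d ⌊p⌋₊ R.X H) [k] = endVal T H k [] - startVal T H k [] :=
        rfl
      simp only [expansion, List.append_nil, hsum] at h3 ⊢
      rw [h4]
      convert h3 using 1
      ring
    · simp at h2

end Control

section StarComp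

variable {d e f : ℕ} {p T : ℝ} {K : ℝ → List (Fin e) → Fin f → ℝ}
  {H : ℝ → List (Fin d) → Fin e → ℝ}

theorem startVal_starComp {N : ℕ} (c : Fin f) {w : List (Fin d)} (hw : w.length ≤ N) {n : ℕ}
    (hn : w.length < n) : startVal T (starComp d e f N K H) c w =
      ∑ ks ∈ wordsBelow (Fin e) n, startVal T K c ks * halfProd (startVal T H) ks w := by
  funext q
  simp only [startVal, starComp_eq K H _ hw c hn, Finset.sum_apply, Pi.mul_apply]
  exact Finset.sum_congr rfl fun ks _ => by
    rw [← Pi.evalRingHom_apply (fun _ : Simplex T => ℝ) q (halfProd _ ks w), map_halfProd]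
    rfl

theorem endVal_starComp {N : ℕ} (c : Fin f) {w : List (Fin d)} (hw : w.length ≤ N) {n : ℕ}
    (hn : w.length < n) : endVal T (starComp d e f N K H) c w =
      ∑ ks ∈ wordsBelow (Fin e) n, endVal T K c ks * halfProd (endVal T H) ks w := by
  funext q
  simp only [endVal, starComp_eq K H _ hw c hn, Finset.sum_apply, Pi.mul_apply]
  exact Finset.sum_congr rfl fun ks _ => by
    rw [← Pi.evalRingHom_apply (fun _ : Simplex T => ℝ) q (halfProd _ ks w), map_halfProd]
    rfl

theorem continuous_starComp {N : ℕ} (hK : ∀ w c, Continuous fun t => K t w c)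
    (hH : ∀ w k, Continuous fun t => H t w k) (w : List (Fin d)) (c : Fin f) :
    Continuous fun t => starComp d e f N K H t w c := by
  unfold starComp
  split_ifs
  · exact continuous_const
  · exact hK [] c
  · exact continuous_finsetSum _ fun m _ => continuous_finsetSum _ fun g _ =>
      continuous_const.mul <| continuous_finsetSum _ fun ks _ =>
        (hK _ c).mul <| continuous_finsetProd _ fun i _ => hH _ _

theorem expansion_starComp {N r : ℕ} (X : List (Fin d) → Simplex T → ℝ) (c : Fin f)
    {w : List (Fin d)} (hw : r + w.length ≤ N + 1) :
    expansion r X (startVal T (starComp d e f N K H) c) w =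
      ∑ ks ∈ wordsBelow (Fin e) (N + 1),
        startVal T K c ks * expansion r X (halfProd (startVal T H) ks) w := by
  simp only [expansion, Finset.mul_sum]
  rw [Finset.sum_comm]
  refine Finset.sum_congr rfl fun u hu => ?_
  have hlen : (u ++ w).length < N + 1 := by
    simp only [mem_wordsBelow, List.length_append] at *
    omega
  rw [startVal_starComp c (Nat.lt_succ_iff.1 hlen) hlen, Finset.sum_mul]
  exact Finset.sum_congr rfl fun ks _ => mul_assoc _ _ _

end StarComp

/-- **change of controlling rough path.** If `H̄ ∈ D_X(U)`,
`𝐇 = ↑_X H̄` is its rough path lift, and `K̄ ∈ D_𝐇(S)`, then the composite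
`K̄ * H̄` (defined level-wise through the reduced ordered-shuffle coproduct)
is an `X`-controlled path in `D_X(S)`. -/
theorem starComp_isControlled (d e f : ℕ) (p T : ℝ) (hp : 1 ≤ p)
    (ω : ℝ → ℝ → ℝ) (hω : IsControl ω T) (R : RoughPath d p T ω)
    (H : ℝ → List (Fin d) → Fin e → ℝ)
    (hH : IsControlledPath d p T ω R.X H)
    (Y : RoughPath e p T ω)
    (hY : ∃ C, ∀ w : List (Fin e), w.length ≤ ⌊p⌋₊ → ∀ s t, 0 ≤ s → s ≤ t → t ≤ T →
      |Y.X s t w - liftApprox d ⌊p⌋₊ R.X H s t w| ≤ C * ω s t ^ (((⌊p⌋₊ : ℝ) + 1) / p))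
    (K : ℝ → List (Fin e) → Fin f → ℝ)
    (hK : IsControlledPath e p T ω Y.X K) :
    IsControlledPath d p T ω R.X (starComp d e f (⌊p⌋₊ - 1) K H) := by
  have hp0 : 0 < p := by linarith
  have h1 : 1 ≤ ⌊p⌋₊ := Nat.le_floor (by simpa using hp)
  set J := controlFiltration hp0 hω with hJ
  have hHs := fun k => hH.startVal_mem hp0 hω k
  have hHt := fun k => hH.endVal_mem hp0 hω k
  have hKs := fun c => hK.startVal_mem hp0 hω c
  have hKt := fun c => hK.endVal_mem hp0 hω c
  have hX := incrVal_mem hp0 hω R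
  have hX0 : incrVal T R.X [] = 1 := funext fun q => R.empty_eq _ _
  refine IsControlledPath.of_mem hp0 hω hp (fun t w c hw => by rw [starComp, if_pos hw])
    (continuous_starComp hK.2.1 hH.2.1) ?_ ?_
  · intro c w hw
    rw [endVal_starComp c hw (Nat.lt_succ_of_le hw), startVal_starComp c hw (Nat.lt_succ_of_le hw),
      ← Finset.sum_sub_distrib]
    exact sum_mem fun ks _ => J.mul_sub_mul_mem (hKt c ks) (J.halfProd_mem hHs ks w)
      (hK.endVal_sub_startVal_mem hp0 hω c ks)
      (J.halfProd_sub_mem hHt hHs (fun k v _ => hH.endVal_sub_startVal_mem hp0 hω k v) ks le_rfl)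
  intro c w hw
  set r := ⌊p⌋₊ - w.length with hr
  have hr0 : 0 < r := by omega
  have hE : ∀ k v, expansion r (incrVal T R.X) (startVal T H k) v ∈ J.toFun 0 :=
    fun k v => J.expansion_mem hX (hHs k) r v
  rw [endVal_starComp c (n := ⌊p⌋₊ - 1 + 1) (by omega) (by omega),
    expansion_starComp _ c (by omega)]
  have hsplit : ∑ ks ∈ wordsBelow (Fin e) (⌊p⌋₊ - 1 + 1), startVal T K c ks *
      expansion r (incrVal T R.X) (halfProd (startVal T H) ks) w -
      ∑ ks ∈ wordsBelow (Fin e) (⌊p⌋₊ - 1 + 1), ∑ i ∈ Finset.range (ks.length + 1),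
        startVal T K c (ks.take i ++ ks.drop i) *
          (expansion r (incrVal T R.X) (halfProd (startVal T H) (ks.take i)) [] *
            halfProd (fun k => expansion r (incrVal T R.X) (startVal T H k)) (ks.drop i) w) ∈
      J.toFun r := by
    simp only [List.take_append_drop, ← Finset.mul_sum]
    rw [← Finset.sum_sub_distrib]
    refine sum_mem fun ks _ => ?_
    rw [← mul_sub]
    exact J.mul_mem_left (hKs c ks) (J.expansion_halfProd_sub_mem hX hX0 hr0
      (fun u v huv => incrVal_mul R u v (by omega)) hHs ks w)
  rw [sum_wordsBelow_splits (⌊p⌋₊ - 1 + 1) fun l m => startVal T K c (l ++ m) *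
    (expansion r (incrVal T R.X) (halfProd (startVal T H) l) [] *
      halfProd (fun k => expansion r (incrVal T R.X) (startVal T H k)) m w),
    sum_wordPairsBelow (⌊p⌋₊ - 1 + 1) fun l m => startVal T K c (l ++ m) *
    (expansion r (incrVal T R.X) (halfProd (startVal T H) l) [] *
      halfProd (fun k => expansion r (incrVal T R.X) (startVal T H k)) m w)] at hsplit
  rw [← sub_sub_sub_cancel_right]
  refine sub_mem ?_ hsplit
  rw [← Finset.sum_sub_distrib]
  refine sum_mem fun ks hks => ?_
  simp only [← mul_assoc, ← Finset.sum_mul]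
  by_cases hlen : w.length < ks.length
  · rw [halfProd_eq_zero _ hlen, halfProd_eq_zero _ hlen, mul_zero, mul_zero, sub_zero]
    exact zero_mem _
  refine J.mul_sub_mul_mem (hKt c ks) (J.halfProd_mem hE ks w) ?_ ?_
  · have hexp := J.anti (by omega : r ≤ ⌊p⌋₊ - ks.length)
      (hK.endVal_sub_expansion_mem hp0 hω hp c (w := ks) (by omega))
    have hlift : ∑ l ∈ wordsBelow (Fin e) (⌊p⌋₊ - ks.length), startVal T K c (l ++ ks) *
        (expansion r (incrVal T R.X) (halfProd (startVal T H) l) [] - incrVal T Y.X l) ∈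
        J.toFun r := by
      refine sum_mem fun l hl => J.mul_mem_left (hKs c _)
        (expansion_halfProd_sub_lift_mem hp0 hω hp hH hY ?_ hr0 (by omega))
      simp only [mem_wordsBelow] at hl
      omega
    have := sub_mem hexp hlift
    simp only [mul_sub, Finset.sum_sub_distrib, expansion] at this ⊢
    rw [Nat.sub_add_cancel h1]
    simpa using this
  · refine J.halfProd_sub_mem hHt hE (fun k v hv => ?_) ks (le_refl w.length)
    exact hH.endVal_sub_expansion_mem_of_le hp0 hω hp k (by omega) (by omega)
end
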